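/- Let n ≥ 2, let K ⊂ ℝ^n be compact, and suppose μ = H¹⌞K (the restriction of 1-dimensional Hausdorff measure to K) is a finite measure. Then μ is 1-rectifiable if and only if both the lower Hausdorff 1-density satisfies Θ¹_*(μ,x) > 0 and the ordinary L² Jones function satisfies J₂(μ,x) < ∞ at μ-almost every x ∈ ℝ^n. -/

import Mathlib

open MeasureTheory Metric Set Filter
open scoped ENNReal NNReal Topology

noncomputable section

/-- The closed dyadic cube in `ℝⁿ` of generation `k` (side length `2^(-k)`) with corner `z`. -/
def dyadicCube (n : ℕ) (k : ℤ) (z : Fin n → ℤ) : Set (EuclideanSpace ℝ (Fin n)) :=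
  {x | ∀ i, (z i : ℝ) * (2 : ℝ) ^ (-k) ≤ x i ∧ x i ≤ ((z i : ℝ) + 1) * (2 : ℝ) ^ (-k)}

/-- The concentric dilate `λQ` of the dyadic cube `Q` of generation `k` with corner `z`. -/
def dilatedCube (n : ℕ) (lam : ℝ) (k : ℤ) (z : Fin n → ℤ) : Set (EuclideanSpace ℝ (Fin n)) :=
  {x | ∀ i, |x i - ((z i : ℝ) + 1 / 2) * (2 : ℝ) ^ (-k)| ≤ lam * (2 : ℝ) ^ (-k) / 2}

/-- The axis-parallel cube with center `c` and side length `s`. -/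
def axisCube {n : ℕ} (c : EuclideanSpace ℝ (Fin n)) (s : ℝ) : Set (EuclideanSpace ℝ (Fin n)) :=
  {x | ∀ i, |x i - c i| ≤ s / 2}

/-- `L` is an (affine) line in `ℝⁿ`. -/
def IsLine {n : ℕ} (L : Set (EuclideanSpace ℝ (Fin n))) : Prop :=
  ∃ p v : EuclideanSpace ℝ (Fin n), v ≠ 0 ∧ L = {x | ∃ t : ℝ, x = p + t • v}

/-- `β₂(μ,Q)²`, the square of the `L²` beta number of `μ` on `Q`:
`inf_ℓ ∫_Q (dist(x,ℓ)/diam Q)² dμ(x)/μ(Q)`. When `μ Q = 0` this equals `0`,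
since `0/0 = 0` in `ℝ≥0∞`. -/
def beta2Sq {n : ℕ} (μ : Measure (EuclideanSpace ℝ (Fin n)))
    (Q : Set (EuclideanSpace ℝ (Fin n))) : ℝ≥0∞ :=
  ⨅ (L : Set (EuclideanSpace ℝ (Fin n))) (_ : IsLine L),
    (∫⁻ x in Q, ENNReal.ofReal ((Metric.infDist x L / Metric.diam Q) ^ 2) ∂μ) / μ Q

/-- The beta number `β_E(Q) = inf_ℓ sup_{x ∈ E ∩ Q} dist(x,ℓ)/diam Q` of a set `E`;
it is `0` when `E ∩ Q = ∅`. -/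
def betaSet {n : ℕ} (E Q : Set (EuclideanSpace ℝ (Fin n))) : ℝ≥0∞ :=
  ⨅ (L : Set (EuclideanSpace ℝ (Fin n))) (_ : IsLine L),
    ⨆ x ∈ E ∩ Q, ENNReal.ofReal (Metric.infDist x L / Metric.diam Q)

-- The ordinary `L²` Jones function at scale `r`:
-- `J₂(μ,r,x) = Σ_Q β₂²(μ,3Q) χ_Q(x)` over dyadic cubes `Q` of side length at most `r`.
open Classical in
def jones2 {n : ℕ} (μ : Measure (EuclideanSpace ℝ (Fin n))) (r : ℝ)
    (x : EuclideanSpace ℝ (Fin n)) : ℝ≥0∞ :=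
  ∑' (k : ℤ) (z : Fin n → ℤ),
    if (2 : ℝ) ^ (-k) ≤ r ∧ x ∈ dyadicCube n k z then beta2Sq μ (dilatedCube n 3 k z) else 0

-- The density-normalized `L²` Jones function at scale `r`:
-- `J̃₂(μ,r,x) = Σ_Q β₂²(μ,3Q) (diam Q / μ(Q)) χ_Q(x)` over dyadic cubes `Q` of side length
-- at most `r`, with the convention `0/0 = 0` (the term vanishes when `μ Q = 0`).
open Classical in
def jones2Tilde {n : ℕ} (μ : Measure (EuclideanSpace ℝ (Fin n))) (r : ℝ)
    (x : EuclideanSpace ℝ (Fin n)) : ℝ≥0∞ :=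
  ∑' (k : ℤ) (z : Fin n → ℤ),
    if (2 : ℝ) ^ (-k) ≤ r ∧ x ∈ dyadicCube n k z then
      (if μ (dyadicCube n k z) = 0 then 0
       else beta2Sq μ (dilatedCube n 3 k z) * ENNReal.ofReal (Metric.diam (dyadicCube n k z))
              / μ (dyadicCube n k z))
    else 0

/-- A measure `μ` on `ℝⁿ` is `1`-rectifiable: countably many bounded Borel sets `Eᵢ ⊆ ℝ` and
Lipschitz maps `fᵢ : Eᵢ → ℝⁿ` whose images carry the full mass of `μ`. -/
def Is1Rectifiable {n : ℕ} (μ : Measure (EuclideanSpace ℝ (Fin n))) : Prop :=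
  ∃ (E : ℕ → Set ℝ) (f : ℕ → ℝ → EuclideanSpace ℝ (Fin n)),
    (∀ i, Bornology.IsBounded (E i) ∧ MeasurableSet (E i) ∧
      ∃ K : ℝ≥0, LipschitzOnWith K (f i) (E i)) ∧
    μ (Set.univ \ ⋃ i, f i '' E i) = 0

/-- A measure `μ` on `ℝⁿ` is `m`-rectifiable: countably many bounded Borel sets `Eᵢ ⊆ ℝᵐ` and
Lipschitz maps `fᵢ : Eᵢ → ℝⁿ` whose images carry the full mass of `μ`. -/
def IsMRectifiable (m : ℕ) {n : ℕ} (μ : Measure (EuclideanSpace ℝ (Fin n))) : Prop :=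
  ∃ (E : ℕ → Set (EuclideanSpace ℝ (Fin m)))
    (f : ℕ → EuclideanSpace ℝ (Fin m) → EuclideanSpace ℝ (Fin n)),
    (∀ i, Bornology.IsBounded (E i) ∧ MeasurableSet (E i) ∧
      ∃ K : ℝ≥0, LipschitzOnWith K (f i) (E i)) ∧
    μ (Set.univ \ ⋃ i, f i '' E i) = 0

/-- A rectifiable curve in `ℝⁿ`: the image of a Lipschitz map on a compact interval. -/
def IsRectifiableCurve {n : ℕ} (Γ : Set (EuclideanSpace ℝ (Fin n))) : Prop :=
  ∃ (f : ℝ → EuclideanSpace ℝ (Fin n)) (a b : ℝ) (K : ℝ≥0),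
    LipschitzOnWith K f (Set.Icc a b) ∧ Γ = f '' Set.Icc a b

/-- The lower Hausdorff `1`-density `Θ¹_*(μ,x) = liminf_{r→0⁺} μ(B(x,r))/(2r)`. -/
def lowerDensity1 {n : ℕ} (μ : Measure (EuclideanSpace ℝ (Fin n)))
    (x : EuclideanSpace ℝ (Fin n)) : ℝ≥0∞ :=
  Filter.liminf (fun r : ℝ => μ (Metric.closedBall x r) / ENNReal.ofReal (2 * r)) (𝓝[>] 0)

/-- The upper Hausdorff `1`-density `Θ*¹(μ,x) = limsup_{r→0⁺} μ(B(x,r))/(2r)`. -/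
def upperDensity1 {n : ℕ} (μ : Measure (EuclideanSpace ℝ (Fin n)))
    (x : EuclideanSpace ℝ (Fin n)) : ℝ≥0∞ :=
  Filter.limsup (fun r : ℝ => μ (Metric.closedBall x r) / ENNReal.ofReal (2 * r)) (𝓝[>] 0)

/-- The lower Hausdorff `m`-density `Θᵐ_*(μ,x) = liminf_{r→0⁺} μ(B(x,r))/(ω_m rᵐ)`, where
`ω_m` is the Lebesgue volume of the unit ball in `ℝᵐ`. -/
def lowerDensity (m : ℕ) {n : ℕ} (μ : Measure (EuclideanSpace ℝ (Fin n)))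
    (x : EuclideanSpace ℝ (Fin n)) : ℝ≥0∞ :=
  Filter.liminf
    (fun r : ℝ => μ (Metric.closedBall x r) /
      (MeasureTheory.volume (Metric.ball (0 : EuclideanSpace ℝ (Fin m)) 1) *
        ENNReal.ofReal (r ^ m)))
    (𝓝[>] 0)

/-- The `δ`-packing prenumber `P^s_δ(A)`: the supremum of `Σᵢ (2rᵢ)^s` over all countable
packings of `A` by disjoint closed balls centered in `A` of diameter at most `δ`. -/
def packingPreAt {X : Type*} [PseudoMetricSpace X] (s δ : ℝ) (A : Set X) : ℝ≥0∞ :=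
  ⨆ (S : Set (X × ℝ)) (_ : S.Countable)
    (_ : ∀ p ∈ S, p.1 ∈ A ∧ 0 < p.2 ∧ 2 * p.2 ≤ δ)
    (_ : S.Pairwise fun p q => Disjoint (Metric.closedBall p.1 p.2) (Metric.closedBall q.1 q.2)),
    ∑' p : S, ENNReal.ofReal ((2 * p.1.2) ^ s)

/-- The `s`-dimensional packing premeasure `P^s(A) = lim_{δ→0⁺} P^s_δ(A)`; since `P^s_δ(A)`
is nonincreasing in `δ`, the limit equals the infimum over `δ > 0`. -/
def packingPre {X : Type*} [PseudoMetricSpace X] (s : ℝ) (A : Set X) : ℝ≥0∞ :=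
  ⨅ (δ : ℝ) (_ : 0 < δ), packingPreAt s δ A

/-- The `s`-dimensional packing measure
`𝒫^s(A) = inf { Σᵢ P^s(Aᵢ) : A = ⋃ᵢ Aᵢ }`. -/
def packingMeasure {X : Type*} [PseudoMetricSpace X] (s : ℝ) (A : Set X) : ℝ≥0∞ :=
  ⨅ (F : ℕ → Set X) (_ : A = ⋃ i, F i), ∑' i, packingPre s (F i)

section Perp

variable {E : Type*} [NormedAddCommGroup E] [InnerProductSpace ℝ E]

/-- The component of `w` orthogonal to the unit vector `v`. -/
def linePerp (v w : E) : E := w - inner ℝ w v • v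

lemma linePerp_add (v w w' : E) : linePerp v (w + w') = linePerp v w + linePerp v w' := by
  simp only [linePerp, inner_add_left, add_smul]; abel

lemma linePerp_sub (v w w' : E) : linePerp v (w - w') = linePerp v w - linePerp v w' := by
  simp only [linePerp, inner_sub_left, sub_smul]; abel

lemma linePerp_smul (v : E) (c : ℝ) (w : E) : linePerp v (c • w) = c • linePerp v w := by
  simp only [linePerp, real_inner_smul_left, smul_sub, smul_smul]

lemma linePerp_self {v : E} (hv : ‖v‖ = 1) : linePerp v v = 0 := by
  simp [linePerp, hv]

lemma inner_linePerp_self {v : E} (hv : ‖v‖ = 1) (w : E) : inner ℝ (linePerp v w) v = 0 := by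
  simp [linePerp, inner_sub_left, real_inner_smul_left, hv]

lemma linePerp_add_inner_smul (v w : E) : linePerp v w + inner ℝ w v • v = w := by
  simp [linePerp]

lemma linePerp_linePerp {v : E} (hv : ‖v‖ = 1) (w : E) :
    linePerp v (linePerp v w) = linePerp v w := by
  rw [linePerp, inner_linePerp_self hv]; simp

lemma inner_eq_linePerp {v : E} (hv : ‖v‖ = 1) (w w' : E) :
    inner ℝ w w' = inner ℝ w v * inner ℝ w' v + inner ℝ (linePerp v w) (linePerp v w') := by
  simp only [linePerp, inner_sub_left, inner_sub_right, real_inner_smul_right,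
    real_inner_self_eq_norm_sq, hv, real_inner_comm]
  ring

lemma norm_sq_eq_linePerp {v : E} (hv : ‖v‖ = 1) (w : E) :
    ‖w‖ ^ 2 = inner ℝ w v ^ 2 + ‖linePerp v w‖ ^ 2 := by
  rw [← real_inner_self_eq_norm_sq, inner_eq_linePerp hv, real_inner_self_eq_norm_sq]; ring

lemma norm_linePerp_le {v : E} (hv : ‖v‖ = 1) (w : E) : ‖linePerp v w‖ ≤ ‖w‖ := by
  have := norm_sq_eq_linePerp hv w
  exact abs_le_of_sq_le_sq' (by nlinarith [sq_nonneg (inner ℝ w v)]) (norm_nonneg _) |>.2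

lemma norm_linePerp_add_le (v w w' : E) :
    ‖linePerp v (w + w')‖ ≤ ‖linePerp v w‖ + ‖linePerp v w'‖ := by
  rw [linePerp_add]; exact norm_add_le _ _

lemma norm_le_inner_add_linePerp {v : E} (hv : ‖v‖ = 1) (w : E) :
    ‖w‖ ≤ |inner ℝ w v| + ‖linePerp v w‖ := by
  calc ‖w‖ = ‖linePerp v w + inner ℝ w v • v‖ := by rw [linePerp_add_inner_smul]
    _ ≤ _ := (norm_add_le _ _).trans (by rw [norm_smul, hv]; simp [add_comm])

lemma abs_inner_unit_le {v : E} (hv : ‖v‖ = 1) (w : E) : |inner ℝ w v| ≤ ‖w‖ := by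
  simpa [hv] using abs_real_inner_le_norm w v

/-- A vector which is almost parallel to `v` has length close to its component along `v`. -/
lemma inner_sq_ge_of_linePerp {v : E} (hv : ‖v‖ = 1) {w : E} {η : ℝ} (h : ‖linePerp v w‖ ≤ η) :
    ‖w‖ ^ 2 - η ^ 2 ≤ inner ℝ w v ^ 2 := by
  have := norm_sq_eq_linePerp hv w
  nlinarith [norm_nonneg (linePerp v w)]

lemma abs_inner_linePerp_le {u : E} (hu : ‖u‖ = 1) (w v : E) :
    |inner ℝ (linePerp u w) v| ≤ ‖linePerp u w‖ * ‖linePerp u v‖ := by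
  have : inner ℝ (linePerp u w) v = inner ℝ (linePerp u w) (linePerp u v) := by
    rw [inner_eq_linePerp hu, inner_linePerp_self hu, linePerp_linePerp hu]; simp
  rw [this]; exact abs_real_inner_le_norm _ _

/-- The length of a perturbed half of an edge changes only to second order. -/
lemma abs_norm_half_add_sub_le {v : E} (hv : ‖v‖ = 1) {e d : E} {b r : ℝ} (hr : 0 < r)
    (hb : 0 ≤ b) (he : ‖linePerp v e‖ ≤ 2 * b * r) (he1 : 9 / 10 * r ≤ ‖e‖)
    (he2 : ‖e‖ ≤ 11 / 10 * r) (hd : ‖d‖ ≤ 4 * b * r) (hdv : |inner ℝ d v| ≤ 4 * b ^ 2 * r) :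
    |‖(1 / 2 : ℝ) • e + d‖ - ‖e‖ / 2| ≤ 65 * b ^ 2 * r := by
  have h1 : ‖(1 / 2 : ℝ) • e + d‖ ^ 2 = ‖e‖ ^ 2 / 4 + inner ℝ e d + ‖d‖ ^ 2 := by
    rw [norm_add_sq_real, norm_smul, real_inner_smul_left]; norm_num; ring
  have h2 : |inner ℝ e d| ≤ 13 * b ^ 2 * r ^ 2 := by
    rw [inner_eq_linePerp hv]
    have a1 : |inner ℝ e v * inner ℝ d v| ≤ (11 / 10 * r) * (4 * b ^ 2 * r) := by
      rw [abs_mul]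
      exact mul_le_mul ((abs_inner_unit_le hv e).trans he2) hdv (abs_nonneg _) (by positivity)
    have a2 : |inner ℝ (linePerp v e) (linePerp v d)| ≤ (2 * b * r) * (4 * b * r) :=
      (abs_real_inner_le_norm _ _).trans
        (mul_le_mul he ((norm_linePerp_le hv d).trans hd) (norm_nonneg _) (by positivity))
    refine (abs_add_le _ _).trans ?_
    nlinarith [sq_nonneg (b * r)]
  have h3 : ‖d‖ ^ 2 ≤ 16 * b ^ 2 * r ^ 2 := by nlinarith [norm_nonneg d]
  set X := ‖(1 / 2 : ℝ) • e + d‖ with hX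
  have hX0 : 0 ≤ X := norm_nonneg _
  have h4 : |X - ‖e‖ / 2| * (X + ‖e‖ / 2) ≤ 29 * b ^ 2 * r ^ 2 := by
    rw [← abs_of_nonneg (by positivity : 0 ≤ X + ‖e‖ / 2), ← abs_mul]
    have : (X - ‖e‖ / 2) * (X + ‖e‖ / 2) = inner ℝ e d + ‖d‖ ^ 2 := by nlinarith
    rw [this]
    refine (abs_add_le _ _).trans ?_
    rw [abs_of_nonneg (sq_nonneg ‖d‖)]
    nlinarith
  have h5 : |X - ‖e‖ / 2| * (9 / 20 * r) ≤ 29 * b ^ 2 * r ^ 2 :=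
    (mul_le_mul_of_nonneg_left (by linarith) (abs_nonneg _)).trans h4
  have h6 : |X - ‖e‖ / 2| * (9 / 20 * r) ≤ (65 * b ^ 2 * r) * (9 / 20 * r) := by nlinarith [sq_nonneg (b * r)]
  exact le_of_mul_le_mul_right h6 (by positivity)

end Perp

section Chain

variable {E : Type*} [NormedAddCommGroup E] [InnerProductSpace ℝ E]

/-- For every `x ∈ A` and every scale `r k`, the line through `p k x` with unit direction `v k x`
passes near `x`; lines attached to nearby points at comparable scales differ by at most
`b k x`, and the `b k x` are uniformly square summable. -/
structure LineSystem (A : Set E) (r : ℕ → ℝ) (p v : ℕ → E → E) (b : ℕ → E → ℝ) : Prop where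
  r_pos : ∀ k, 0 < r k
  r_succ : ∀ k, r (k + 1) = r k / 2
  unit : ∀ k x, ‖v k x‖ = 1
  b_nonneg : ∀ k x, 0 ≤ b k x
  near : ∀ k, ∀ x ∈ A, ‖linePerp (v k x) (x - p k x)‖ ≤ r k / 100
  dir : ∀ k, ∀ x ∈ A, ∀ y ∈ A, ‖x - y‖ ≤ 50 * r k → ‖linePerp (v (k + 1) y) (v k x)‖ ≤ b k x
  next : ∀ k, ∀ x ∈ A, ∀ y ∈ A, ‖x - y‖ ≤ 50 * r k → ∀ z, ‖z - x‖ ≤ 50 * r k →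
    ‖linePerp (v (k + 1) y) (z - p (k + 1) y)‖ ≤ ‖linePerp (v k x) (z - p k x)‖ + b k x * r k
  same : ∀ k, ∀ x ∈ A, ∀ y ∈ A, ‖x - y‖ ≤ 50 * r k → ∀ z, ‖z - x‖ ≤ 50 * r k →
    ‖linePerp (v k x) (z - p k x)‖ ≤ ‖linePerp (v k y) (z - p k y)‖ + b k x * r k
  sum_le : ∀ k, ∀ x ∈ A, ∑ j ∈ Finset.range k, b j x ^ 2 ≤ 1 / 10000

/-- A bi-infinite polygonal chain at scale `r k` which follows the lines of a line system. -/
structure ChainAt (A : Set E) (r : ℕ → ℝ) (p v : ℕ → E → E) (b : ℕ → E → ℝ) (q v₀ : E)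
    (k : ℕ) (z : ℤ → E) : Prop where
  near : ∀ x ∈ A, ∀ i, ‖z i - x‖ ≤ 12 * r k → ‖linePerp (v k x) (z i - p k x)‖ ≤ b k x * r k
  length : ∀ x ∈ A, ∀ i, ‖z i - x‖ ≤ 10 * r k →
    |‖z (i + 1) - z i‖ - r k| ≤ 130 * (∑ j ∈ Finset.range k, b j x ^ 2) * r k
  turn : ∀ x ∈ A, ∀ i, ‖z i - x‖ ≤ 10 * r k → 0 < inner ℝ (z i - z (i - 1)) (z (i + 1) - z i)
  short : ∀ i, ‖z (i + 1) - z i‖ ≤ 11 / 10 * r k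
  cover : ∀ x ∈ A, ∃ i, ‖z i - x‖ ≤ 3 * r k
  drift : ∀ i : ℤ, ‖z i - (q + ((i : ℝ) * r k) • v₀)‖ ≤ r 0 - r k

open Classical in
/-- Points within `ρ` of `A` are projected to the line attached to a nearby point of `A`. -/
def snap (A : Set E) (ρ : ℝ) (p v : E → E) (z : E) : E :=
  if h : ∃ y ∈ A, ‖z - y‖ ≤ ρ then z - linePerp (v h.choose) (z - p h.choose) else z

lemma snap_spec (A : Set E) (ρ : ℝ) (p v : E → E) (z : E) :
    (∃ y ∈ A, ‖z - y‖ ≤ ρ ∧ snap A ρ p v z = z - linePerp (v y) (z - p y)) ∨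
      ((∀ y ∈ A, ρ < ‖z - y‖) ∧ snap A ρ p v z = z) := by
  by_cases h : ∃ y ∈ A, ‖z - y‖ ≤ ρ
  · exact Or.inl ⟨h.choose, h.choose_spec.1, h.choose_spec.2, by rw [snap, dif_pos h]⟩
  · refine Or.inr ⟨fun y hy => ?_, by rw [snap, dif_neg h]⟩
    by_contra hc
    exact h ⟨y, hy, not_lt.mp hc⟩

variable {A : Set E} {r : ℕ → ℝ} {p v : ℕ → E → E} {b : ℕ → E → ℝ}

lemma LineSystem.b_le (S : LineSystem A r p v b) (k : ℕ) {x : E} (hx : x ∈ A) :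
    b k x ≤ 1 / 100 := by
  have h := S.sum_le (k + 1) x hx
  rw [Finset.sum_range_succ] at h
  have : 0 ≤ ∑ j ∈ Finset.range k, b j x ^ 2 := Finset.sum_nonneg fun _ _ => sq_nonneg _
  nlinarith [S.b_nonneg k x]

lemma LineSystem.snap_move (S : LineSystem A r p v b) {k : ℕ} {x z : E} (hx : x ∈ A)
    (hzx : ‖z - x‖ ≤ 12 * r k) (hz : ‖linePerp (v k x) (z - p k x)‖ ≤ b k x * r k) :
    ‖snap A (7 * r k) (p (k + 1)) (v (k + 1)) z - z‖ ≤ 2 * b k x * r k ∧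
      |inner ℝ (snap A (7 * r k) (p (k + 1)) (v (k + 1)) z - z) (v k x)|
        ≤ 2 * b k x ^ 2 * r k := by
  have hr := S.r_pos k
  have hb := S.b_nonneg k x
  rcases snap_spec A (7 * r k) (p (k + 1)) (v (k + 1)) z with ⟨y, hy, hzy, h⟩ | ⟨-, h⟩
  · have hxy : ‖x - y‖ ≤ 50 * r k := by
      have := norm_sub_le_norm_sub_add_norm_sub x z y
      rw [norm_sub_rev x z] at this
      linarith
    have h1 := S.next k x hx y hy hxy z (by linarith)
    have h2 := S.dir k x hx y hy hxy
    rw [h, sub_sub_cancel_left, norm_neg, inner_neg_left, abs_neg]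
    have h3 : ‖linePerp (v (k + 1) y) (z - p (k + 1) y)‖ ≤ 2 * b k x * r k := by linarith
    refine ⟨h3, (abs_inner_linePerp_le (S.unit _ _) _ _).trans ?_⟩
    calc _ ≤ (2 * b k x * r k) * b k x := mul_le_mul h3 h2 (norm_nonneg _) (by positivity)
      _ = _ := by ring
  · rw [h]; simp; exact ⟨by positivity, by positivity⟩

variable {q v₀ : E} {k : ℕ} {z : ℤ → E}

lemma ChainAt.dist_succ_le (Z : ChainAt A r p v b q v₀ k z) (x : E) (i : ℤ) :
    ‖z (i + 1) - x‖ ≤ ‖z i - x‖ + 11 / 10 * r k := by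
  have := norm_sub_le_norm_sub_add_norm_sub (z (i + 1)) (z i) x
  have := Z.short i
  linarith

lemma ChainAt.dist_le_succ (Z : ChainAt A r p v b q v₀ k z) (x : E) (i : ℤ) :
    ‖z i - x‖ ≤ ‖z (i + 1) - x‖ + 11 / 10 * r k := by
  have := norm_sub_le_norm_sub_add_norm_sub (z i) (z (i + 1)) x
  have := Z.short i
  rw [norm_sub_rev] at this
  linarith

/-- Edges of the chain near `A` have length about `r k` and are almost parallel to the lines. -/
lemma ChainAt.edge (S : LineSystem A r p v b) (Z : ChainAt A r p v b q v₀ k z) {x : E}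
    (hx : x ∈ A) {i : ℤ} (hi : ‖z i - x‖ ≤ 10 * r k) :
    ‖linePerp (v k x) (z (i + 1) - z i)‖ ≤ 2 * b k x * r k ∧
      49 / 50 * r k ≤ ‖z (i + 1) - z i‖ ∧ 9 / 10 * r k ≤ |inner ℝ (z (i + 1) - z i) (v k x)| := by
  have hr := S.r_pos k
  have h1 := Z.near x hx i (by linarith)
  have h2 := Z.near x hx (i + 1) (by have := Z.dist_succ_le x i; linarith)
  have h3 : ‖linePerp (v k x) (z (i + 1) - z i)‖ ≤ 2 * b k x * r k := by
    rw [← sub_sub_sub_cancel_right _ _ (p k x), linePerp_sub]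
    refine (norm_sub_le _ _).trans (by linarith)
  have h4 := (abs_le.mp (Z.length x hx i hi)).1
  have h5 := S.sum_le k x hx
  have h6 : 49 / 50 * r k ≤ ‖z (i + 1) - z i‖ := by nlinarith
  refine ⟨h3, h6, ?_⟩
  have h7 := inner_sq_ge_of_linePerp (S.unit k x) h3
  have h8 := S.b_le k hx
  have h9 := S.b_nonneg k x
  have h10 : (2 * b k x * r k) ^ 2 ≤ (1 / 50 * r k) ^ 2 := by
    gcongr; linarith
  apply abs_le_of_sq_le_sq' _ (abs_nonneg _) |>.2
  rw [sq_abs]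
  nlinarith

/-- The midpoint refinement of a chain. -/
def midChain (z : ℤ → E) (m : ℤ) : E := (1 / 2 : ℝ) • (z (m / 2) + z ((m + 1) / 2))

lemma midChain_cases (z : ℤ → E) (m : ℤ) :
    (midChain z m = z (m / 2) ∧ midChain z (m + 1) = (1 / 2 : ℝ) • (z (m / 2) + z (m / 2 + 1))) ∨
    (midChain z m = (1 / 2 : ℝ) • (z (m / 2) + z (m / 2 + 1)) ∧
      midChain z (m + 1) = z (m / 2 + 1)) := by
  have half : ∀ a : E, (1 / 2 : ℝ) • (a + a) = a := fun a => by
    rw [← two_smul ℝ, smul_smul]; norm_num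
  unfold midChain
  rcases Int.even_or_odd' m with ⟨i, rfl | rfl⟩
  · left
    have e1 : (2 * i) / 2 = i := by omega
    have e2 : (2 * i + 1) / 2 = i := by omega
    have e3 : (2 * i + 1 + 1) / 2 = i + 1 := by omega
    rw [e1, e2, e3]
    exact ⟨half _, rfl⟩
  · right
    have e2 : (2 * i + 1) / 2 = i := by omega
    have e3 : (2 * i + 1 + 1) / 2 = i + 1 := by omega
    have e4 : (2 * i + 1 + 1 + 1) / 2 = i + 1 := by omega
    rw [e2, e3, e4]
    exact ⟨rfl, half _⟩

lemma midChain_sub (z : ℤ → E) (m : ℤ) :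
    midChain z (m + 1) - midChain z m = (1 / 2 : ℝ) • (z (m / 2 + 1) - z (m / 2)) := by
  rcases midChain_cases z m with ⟨h1, h2⟩ | ⟨h1, h2⟩ <;> rw [h1, h2] <;> module

lemma ChainAt.norm_midChain_sub (Z : ChainAt A r p v b q v₀ k z) (m : ℤ) :
    ‖midChain z m - z (m / 2)‖ ≤ 11 / 20 * r k := by
  have hs := Z.short (m / 2)
  have h0 := norm_nonneg (z (m / 2 + 1) - z (m / 2))
  rcases midChain_cases z m with ⟨h1, -⟩ | ⟨h1, -⟩
  · rw [h1, sub_self, norm_zero]; linarith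
  · have : midChain z m - z (m / 2) = (1 / 2 : ℝ) • (z (m / 2 + 1) - z (m / 2)) := by
      rw [h1]; module
    rw [this, norm_smul]; norm_num; linarith

lemma ChainAt.norm_midChain_succ_sub (Z : ChainAt A r p v b q v₀ k z) (m : ℤ) :
    ‖midChain z (m + 1) - z (m / 2)‖ ≤ 11 / 10 * r k := by
  have hs := Z.short (m / 2)
  have h0 := norm_nonneg (z (m / 2 + 1) - z (m / 2))
  rcases midChain_cases z m with ⟨-, h1⟩ | ⟨-, h1⟩
  · have : midChain z (m + 1) - z (m / 2) = (1 / 2 : ℝ) • (z (m / 2 + 1) - z (m / 2)) := by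
      rw [h1]; module
    rw [this, norm_smul]; norm_num; linarith
  · rw [h1]; exact hs

lemma ChainAt.midChain_near (S : LineSystem A r p v b) (Z : ChainAt A r p v b q v₀ k z) {x : E}
    (hx : x ∈ A) {m : ℤ} (hm : ‖z (m / 2) - x‖ ≤ 10 * r k) :
    ‖linePerp (v k x) (midChain z m - p k x)‖ ≤ b k x * r k ∧
      ‖linePerp (v k x) (midChain z (m + 1) - p k x)‖ ≤ b k x * r k := by
  have hr := S.r_pos k
  have h1 := Z.near x hx (m / 2) (by linarith)
  have h2 := Z.near x hx (m / 2 + 1) (by have := Z.dist_succ_le x (m / 2); linarith)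
  have h3 : ‖linePerp (v k x) ((1 / 2 : ℝ) • (z (m / 2) + z (m / 2 + 1)) - p k x)‖
      ≤ b k x * r k := by
    have : (1 / 2 : ℝ) • (z (m / 2) + z (m / 2 + 1)) - p k x
        = (1 / 2 : ℝ) • ((z (m / 2) - p k x) + (z (m / 2 + 1) - p k x)) := by module
    rw [this, linePerp_smul, norm_smul]
    have := norm_linePerp_add_le (v k x) (z (m / 2) - p k x) (z (m / 2 + 1) - p k x)
    norm_num; linarith
  rcases midChain_cases z m with ⟨h4, h5⟩ | ⟨h4, h5⟩ <;> rw [h4, h5] <;> constructor <;> assumption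

/-- The refinement of a chain: insert midpoints and project to the lines of the next scale. -/
def refineChain (A : Set E) (r : ℕ → ℝ) (p v : ℕ → E → E) (k : ℕ) (z : ℤ → E) (m : ℤ) : E :=
  snap A (7 * r k) (p (k + 1)) (v (k + 1)) (midChain z m)

/-- Each edge of the refinement is half of an old edge, up to a small error which is of second
order in the direction of the line. -/
lemma ChainAt.refine_edge (S : LineSystem A r p v b) (Z : ChainAt A r p v b q v₀ k z) {x : E}
    (hx : x ∈ A) {m : ℤ} (hm : ‖z (m / 2) - x‖ ≤ 10 * r k) :
    ∃ d, refineChain A r p v k z (m + 1) - refineChain A r p v k z m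
        = (1 / 2 : ℝ) • (z (m / 2 + 1) - z (m / 2)) + d ∧ ‖d‖ ≤ 4 * b k x * r k ∧
      |inner ℝ d (v k x)| ≤ 4 * b k x ^ 2 * r k := by
  have hr := S.r_pos k
  obtain ⟨n1, n2⟩ := Z.midChain_near S hx hm
  have d1 : ‖midChain z m - x‖ ≤ 12 * r k := by
    have := norm_sub_le_norm_sub_add_norm_sub (midChain z m) (z (m / 2)) x
    have := Z.norm_midChain_sub m
    linarith
  have d2 : ‖midChain z (m + 1) - x‖ ≤ 12 * r k := by
    have := norm_sub_le_norm_sub_add_norm_sub (midChain z (m + 1)) (z (m / 2)) x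
    have := Z.norm_midChain_succ_sub m
    linarith
  obtain ⟨a1, a2⟩ := S.snap_move hx d1 n1
  obtain ⟨c1, c2⟩ := S.snap_move hx d2 n2
  refine ⟨(refineChain A r p v k z (m + 1) - midChain z (m + 1)) -
    (refineChain A r p v k z m - midChain z m), ?_, ?_, ?_⟩
  · rw [← midChain_sub]; abel
  · refine (norm_sub_le _ _).trans ?_
    unfold refineChain; linarith
  · rw [inner_sub_left]
    refine (abs_sub _ _).trans ?_
    unfold refineChain; linarith

lemma ChainAt.refine_move (S : LineSystem A r p v b) (Z : ChainAt A r p v b q v₀ k z) (m : ℤ) :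
    ‖refineChain A r p v k z m - midChain z m‖ ≤ 1 / 50 * r k := by
  have hr := S.r_pos k
  rcases snap_spec A (7 * r k) (p (k + 1)) (v (k + 1)) (midChain z m) with ⟨y, hy, hzy, h⟩ | ⟨-, h⟩
  · have h1 : ‖z (m / 2) - y‖ ≤ 10 * r k := by
      have := norm_sub_le_norm_sub_add_norm_sub (z (m / 2)) (midChain z m) y
      have := Z.norm_midChain_sub m
      rw [norm_sub_rev] at this
      linarith
    have := (S.snap_move hy (by linarith) (Z.midChain_near S hy h1).1).1
    have h2 := S.b_le k hy
    unfold refineChain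
    nlinarith
  · unfold refineChain; rw [h]; simp; linarith

lemma ChainAt.abs_refine_length (S : LineSystem A r p v b) (Z : ChainAt A r p v b q v₀ k z) {x : E}
    (hx : x ∈ A) {m : ℤ} (hm : ‖z (m / 2) - x‖ ≤ 10 * r k) :
    |‖refineChain A r p v k z (m + 1) - refineChain A r p v k z m‖ - r (k + 1)|
      ≤ 130 * (∑ j ∈ Finset.range (k + 1), b j x ^ 2) * r (k + 1) := by
  obtain ⟨d, h1, h2, h3⟩ := Z.refine_edge S hx hm
  obtain ⟨e1, e2, -⟩ := Z.edge S hx hm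
  have hr := S.r_pos k
  have h4 := abs_norm_half_add_sub_le (S.unit k x) hr (S.b_nonneg k x) e1 (by linarith)
    (Z.short _) h2 h3
  have h5 := Z.length x hx _ hm
  rw [h1, S.r_succ, Finset.sum_range_succ]
  rw [abs_le] at *
  constructor <;> linarith

lemma ChainAt.refine_turn (S : LineSystem A r p v b) (Z : ChainAt A r p v b q v₀ k z) {x : E}
    (hx : x ∈ A) {m : ℤ} (hm : ‖z (m / 2) - x‖ ≤ 8 * r k) :
    0 < inner ℝ (refineChain A r p v k z m - refineChain A r p v k z (m - 1))
      (refineChain A r p v k z (m + 1) - refineChain A r p v k z m) := by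
  have hr := S.r_pos k
  have hb := S.b_nonneg k x
  have hb' := S.b_le k hx
  have hu := S.unit k x
  have hm' : ‖z ((m - 1) / 2) - x‖ ≤ 10 * r k := by
    have : (m - 1) / 2 = m / 2 ∨ (m - 1) / 2 + 1 = m / 2 := by omega
    rcases this with h | h
    · rw [h]; linarith
    · have := Z.dist_le_succ x ((m - 1) / 2)
      rw [h] at this; linarith
  obtain ⟨d, h1, h2, -⟩ := Z.refine_edge S hx (hm.trans (by linarith))
  obtain ⟨d', h1', h2', -⟩ := Z.refine_edge S hx hm'
  obtain ⟨e1, e2, e3⟩ := Z.edge S hx (hm.trans (by linarith : _ ≤ 10 * r k))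
  obtain ⟨e1', e2', e3'⟩ := Z.edge S hx hm'
  rw [sub_add_cancel] at h1'
  have hs := Z.short (m / 2)
  have hs' := Z.short ((m - 1) / 2)
  have hturn : 0 < inner ℝ (z ((m - 1) / 2 + 1) - z ((m - 1) / 2)) (z (m / 2 + 1) - z (m / 2)) := by
    have : (m - 1) / 2 = m / 2 ∨ (m - 1) / 2 + 1 = m / 2 := by omega
    rcases this with h | h
    · rw [h, real_inner_self_eq_norm_sq]; nlinarith
    · have h' : (m - 1) / 2 = m / 2 - 1 := by omega
      rw [h, h']; exact Z.turn x hx _ (by linarith)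
  rw [h1, h1']
  set e := z (m / 2 + 1) - z (m / 2)
  set e' := z ((m - 1) / 2 + 1) - z ((m - 1) / 2)
  have i1 := inner_eq_linePerp hu e' e
  have bd : b k x * r k ≤ 1 / 100 * r k := by nlinarith
  have e4 : ‖linePerp (v k x) e‖ ≤ 1 / 50 * r k := by linarith
  have e4' : ‖linePerp (v k x) e'‖ ≤ 1 / 50 * r k := by linarith
  have i2 : |inner ℝ (linePerp (v k x) e') (linePerp (v k x) e)| ≤ (1 / 50 * r k) * (1 / 50 * r k) :=
    (abs_real_inner_le_norm _ _).trans (mul_le_mul e4' e4 (norm_nonneg _) (by positivity))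
  have i3 : (9 / 10 * r k) * (9 / 10 * r k) ≤ |inner ℝ e' (v k x) * inner ℝ e (v k x)| := by
    rw [abs_mul]; exact mul_le_mul e3' e3 (by positivity) (abs_nonneg _)
  have i4 : 4 / 5 * r k ^ 2 ≤ inner ℝ e' e := by
    have := abs_le.mp i2
    rcases abs_cases (inner ℝ e' (v k x) * inner ℝ e (v k x)) with ⟨h, -⟩ | ⟨h, -⟩ <;>
      rw [h] at i3 <;> nlinarith
  have k1 : |inner ℝ e' d| ≤ (11 / 10 * r k) * (1 / 25 * r k) :=
    (abs_real_inner_le_norm _ _).trans (mul_le_mul hs' (by linarith) (norm_nonneg _) (by positivity))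
  have k2 : |inner ℝ d' e| ≤ (1 / 25 * r k) * (11 / 10 * r k) :=
    (abs_real_inner_le_norm _ _).trans (mul_le_mul (by linarith) hs (norm_nonneg _) (by positivity))
  have k3 : |inner ℝ d' d| ≤ (1 / 25 * r k) * (1 / 25 * r k) :=
    (abs_real_inner_le_norm _ _).trans
      (mul_le_mul (by linarith) (by linarith) (norm_nonneg _) (by positivity))
  rw [abs_le] at k1 k2 k3
  simp only [inner_add_left, inner_add_right, real_inner_smul_left, real_inner_smul_right]
  nlinarith

/-- If a chain covers `x` at scale `3 * r k`, some node is in fact closer to `x`. -/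
lemma ChainAt.exists_close (S : LineSystem A r p v b) (Z : ChainAt A r p v b q v₀ k z) {x : E}
    (hx : x ∈ A) : ∃ i, ‖z i - x‖ ≤ 83 / 100 * r k := by
  have hr := S.r_pos k
  have hb' := S.b_le k hx
  have hu := S.unit k x
  have hbd : BddBelow (range fun i => ‖z i - x‖) := ⟨0, by rintro _ ⟨i, rfl⟩; exact norm_nonneg _⟩
  obtain ⟨i, hi⟩ := exists_lt_of_ciInf_lt (lt_add_of_pos_right (⨅ i, ‖z i - x‖)
    (by positivity : 0 < 1 / 100 * r k))
  have hmin : ∀ j, ‖z i - x‖ ≤ ‖z j - x‖ + 1 / 100 * r k := fun j => by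
    have := ciInf_le hbd j; linarith
  have hi3 : ‖z i - x‖ ≤ 4 * r k := by
    obtain ⟨j, hj⟩ := Z.cover x hx
    have := hmin j; linarith
  have perp : ∀ j, ‖z j - x‖ ≤ 12 * r k → ‖linePerp (v k x) (z j - x)‖ ≤ 1 / 50 * r k := fun j hj => by
    have h1 := Z.near x hx j hj
    have h2 := S.near k x hx
    rw [← sub_sub_sub_cancel_right _ _ (p k x), linePerp_sub]
    refine (norm_sub_le _ _).trans ?_
    nlinarith
  have hi' : ‖z (i - 1) - x‖ ≤ 6 * r k := by
    have := Z.dist_le_succ x (i - 1)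
    rw [sub_add_cancel] at this; linarith
  have hi'' : ‖z (i + 1) - x‖ ≤ 6 * r k := by
    have := Z.dist_succ_le x i; linarith
  obtain ⟨e1, e2, e3⟩ := Z.edge S hx (hi3.trans (by linarith))
  obtain ⟨e1', e2', e3'⟩ := Z.edge S hx (hi'.trans (by linarith))
  have ht := Z.turn x hx i (by linarith)
  have hs := Z.short i
  have hs' := Z.short (i - 1)
  rw [sub_add_cancel] at e1' e2' e3' hs'
  have p0 := perp i (by linarith)
  have n1 := norm_le_inner_add_linePerp hu (z (i + 1) - x)
  have n2 := norm_le_inner_add_linePerp hu (z (i - 1) - x)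
  have n0 := norm_le_inner_add_linePerp hu (z i - x)
  have p1 := perp (i + 1) (by linarith)
  have p2 := perp (i - 1) (by linarith)
  have m1 := hmin (i + 1)
  have m2 := hmin (i - 1)
  have l0 := abs_inner_unit_le hu (z i - x)
  have s1 : inner ℝ (z (i + 1) - x) (v k x) =
      inner ℝ (z i - x) (v k x) + inner ℝ (z (i + 1) - z i) (v k x) := by
    rw [← inner_add_left]; congr 1; abel
  have s2 : inner ℝ (z (i - 1) - x) (v k x) =
      inner ℝ (z i - x) (v k x) - inner ℝ (z i - z (i - 1)) (v k x) := by
    rw [← inner_sub_left]; congr 1; abel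
  have b1 := (abs_inner_unit_le hu (z (i + 1) - z i)).trans hs
  have b2 := (abs_inner_unit_le hu (z i - z (i - 1))).trans hs'
  have bd : b k x * r k ≤ 1 / 100 * r k := by nlinarith
  have i2 : |inner ℝ (linePerp (v k x) (z i - z (i - 1))) (linePerp (v k x) (z (i + 1) - z i))|
      ≤ (1 / 50 * r k) * (1 / 50 * r k) :=
    (abs_real_inner_le_norm _ _).trans
      (mul_le_mul (by linarith) (by linarith) (norm_nonneg _) (by positivity))
  rw [inner_eq_linePerp hu] at ht
  rw [s1] at n1
  rw [s2] at n2
  generalize inner ℝ (z i - x) (v k x) = α at *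
  generalize inner ℝ (z (i + 1) - z i) (v k x) = β at *
  generalize inner ℝ (z i - z (i - 1)) (v k x) = γ at *
  have i3 := (abs_le.mp i2).2
  refine ⟨i, ?_⟩
  have hα : |α| ≤ 4 / 5 * r k := by
    by_contra hc
    push Not at hc
    have hsign : 0 < γ * β := by
      by_contra hneg
      have : (9 / 10 * r k) * (9 / 10 * r k) ≤ |γ| * |β| :=
        mul_le_mul e3' e3 (by positivity) (abs_nonneg _)
      rw [← abs_mul, abs_of_nonpos (not_lt.mp hneg)] at this
      nlinarith
    rcases pos_and_pos_or_neg_and_neg_of_mul_pos hsign with ⟨hγ, hβ⟩ | ⟨hγ, hβ⟩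
    · rw [abs_of_pos hγ] at *
      rw [abs_of_pos hβ] at *
      rcases abs_cases α with ⟨h, h'⟩ | ⟨h, h'⟩
      · have : |α - γ| ≤ α - 1 / 4 * r k := abs_le.mpr ⟨by linarith, by linarith⟩
        linarith
      · have : |α + β| ≤ -α - 1 / 4 * r k := abs_le.mpr ⟨by linarith, by linarith⟩
        linarith
    · rw [abs_of_neg hγ] at *
      rw [abs_of_neg hβ] at *
      rcases abs_cases α with ⟨h, h'⟩ | ⟨h, h'⟩
      · have : |α + β| ≤ α - 1 / 4 * r k := abs_le.mpr ⟨by linarith, by linarith⟩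
        linarith
      · have : |α - γ| ≤ -α - 1 / 4 * r k := abs_le.mpr ⟨by linarith, by linarith⟩
        linarith
  linarith

lemma ChainAt.refine (S : LineSystem A r p v b)
    (Z : ChainAt A r p v b q v₀ k z) :
    ChainAt A r p v b q v₀ (k + 1) (refineChain A r p v k z) := by
  have hr := S.r_pos k
  have hsucc := S.r_succ k
  have half : ∀ (x : E) (m : ℤ) (c : ℝ), ‖refineChain A r p v k z m - x‖ ≤ c * r k →
      ‖z (m / 2) - x‖ ≤ (c + 1) * r k := fun x m c h => by
    have h1 := Z.refine_move S m
    have h2 := Z.norm_midChain_sub m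
    have h3 := norm_sub_le_norm_sub_add_norm_sub (z (m / 2)) (midChain z m) x
    have h4 := norm_sub_le_norm_sub_add_norm_sub (midChain z m) (refineChain A r p v k z m) x
    rw [norm_sub_rev] at h1 h2
    linarith
  refine ⟨?_, ?_, ?_, ?_, ?_, ?_⟩
  · intro x hx m hm
    have h1 := Z.refine_move S m
    rcases snap_spec A (7 * r k) (p (k + 1)) (v (k + 1)) (midChain z m) with
      ⟨y, hy, hzy, h⟩ | ⟨h', h⟩
    · have hyx : ‖x - y‖ ≤ 50 * r (k + 1) := by
        have h3 := norm_sub_le_norm_sub_add_norm_sub x (midChain z m) y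
        have h4 := norm_sub_le_norm_sub_add_norm_sub x (refineChain A r p v k z m) (midChain z m)
        rw [norm_sub_rev x (refineChain A r p v k z m)] at h4
        linarith
      have h5 := S.same (k + 1) x hx y hy hyx (refineChain A r p v k z m) (by linarith)
      have h6 : linePerp (v (k + 1) y) (refineChain A r p v k z m - p (k + 1) y) = 0 := by
        have : refineChain A r p v k z m = _ := h
        rw [this, sub_right_comm, linePerp_sub, linePerp_linePerp (S.unit _ _), sub_self]
      rw [h6, norm_zero, zero_add] at h5
      exact h5
    · have h2 := h' x hx
      have : refineChain A r p v k z m = midChain z m := h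
      rw [this] at hm
      linarith
  · intro x hx m hm
    exact Z.abs_refine_length S hx ((half x m 5 (by linarith)).trans (by linarith))
  · intro x hx m hm
    exact Z.refine_turn S hx ((half x m 5 (by linarith)).trans (by linarith))
  · intro m
    have key : ∀ y ∈ A, ‖z (m / 2) - y‖ ≤ 10 * r k →
        ‖refineChain A r p v k z (m + 1) - refineChain A r p v k z m‖ ≤ 11 / 10 * r (k + 1) := by
      intro y hy h
      have h1 := Z.abs_refine_length S hy h
      have h2 := S.sum_le (k + 1) y hy
      have h3 := (abs_le.mp h1).2
      have h4 := S.r_pos (k + 1)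
      nlinarith
    rcases snap_spec A (7 * r k) (p (k + 1)) (v (k + 1)) (midChain z m) with
      ⟨y, hy, hzy, h⟩ | ⟨-, h⟩
    · apply key y hy
      have := norm_sub_le_norm_sub_add_norm_sub (z (m / 2)) (midChain z m) y
      have := Z.norm_midChain_sub m
      rw [norm_sub_rev] at this
      linarith
    rcases snap_spec A (7 * r k) (p (k + 1)) (v (k + 1)) (midChain z (m + 1)) with
      ⟨y, hy, hzy, h'⟩ | ⟨-, h'⟩
    · apply key y hy
      have := norm_sub_le_norm_sub_add_norm_sub (z (m / 2)) (midChain z (m + 1)) y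
      have := Z.norm_midChain_succ_sub m
      rw [norm_sub_rev] at this
      linarith
    unfold refineChain
    rw [h, h', midChain_sub, norm_smul]
    have := Z.short (m / 2)
    norm_num; linarith
  · intro x hx
    obtain ⟨i, hi⟩ := Z.exists_close S hx
    refine ⟨2 * i, ?_⟩
    have h1 := Z.refine_move S (2 * i)
    have h2 : midChain z (2 * i) = z i := by
      have e1 : (2 * i) / 2 = i := by omega
      have e2 : (2 * i + 1) / 2 = i := by omega
      rw [midChain, e1, e2, ← two_smul ℝ, smul_smul]; norm_num
    rw [h2] at h1
    have := norm_sub_le_norm_sub_add_norm_sub (refineChain A r p v k z (2 * i)) (z i) x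
    linarith
  · intro m
    have h1 := Z.refine_move S m
    have h2 := Z.drift (m / 2)
    have h3 := Z.drift ((m + 1) / 2)
    have h4 : ((m / 2 : ℤ) : ℝ) + (((m + 1) / 2 : ℤ) : ℝ) = m := by
      norm_cast; omega
    have h5 : midChain z m - (q + ((m : ℝ) * r (k + 1)) • v₀) = (1 / 2 : ℝ) •
        ((z (m / 2) - (q + (((m / 2 : ℤ) : ℝ) * r k) • v₀)) +
          (z ((m + 1) / 2) - (q + ((((m + 1) / 2 : ℤ) : ℝ) * r k) • v₀))) := by
      rw [midChain, hsucc, ← h4]; module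
    have h6 : ‖midChain z m - (q + ((m : ℝ) * r (k + 1)) • v₀)‖ ≤ r 0 - r k := by
      rw [h5, norm_smul]
      have := norm_add_le (z (m / 2) - (q + (((m / 2 : ℤ) : ℝ) * r k) • v₀))
        (z ((m + 1) / 2) - (q + ((((m + 1) / 2 : ℤ) : ℝ) * r k) • v₀))
      norm_num at this ⊢; linarith
    have := norm_sub_le_norm_sub_add_norm_sub (refineChain A r p v k z m) (midChain z m)
      (q + ((m : ℝ) * r (k + 1)) • v₀)
    linarith

end Chain

section Limit

variable {E : Type*} [NormedAddCommGroup E] [InnerProductSpace ℝ E]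
variable {A : Set E} {r : ℕ → ℝ} {p v : ℕ → E → E} {b : ℕ → E → ℝ}

/-- The initial straight chain. -/
lemma LineSystem.chainAt_zero (S : LineSystem A r p v b) {x₀ : E} (hx₀ : x₀ ∈ A)
    (hA : A ⊆ closedBall x₀ (r 0)) :
    ChainAt A r p v b (x₀ - linePerp (v 0 x₀) (x₀ - p 0 x₀)) (v 0 x₀) 0
      (fun i => x₀ - linePerp (v 0 x₀) (x₀ - p 0 x₀) + ((i : ℝ) * r 0) • v 0 x₀) := by
  have hr := S.r_pos 0
  have hu := S.unit 0 x₀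
  have step : ∀ i : ℤ, (x₀ - linePerp (v 0 x₀) (x₀ - p 0 x₀) + (((i + 1 : ℤ) : ℝ) * r 0) • v 0 x₀) -
      (x₀ - linePerp (v 0 x₀) (x₀ - p 0 x₀) + ((i : ℝ) * r 0) • v 0 x₀) = r 0 • v 0 x₀ := by
    intro i
    push_cast
    module
  have hnorm : ‖r 0 • v 0 x₀‖ = r 0 := by rw [norm_smul, hu, mul_one, Real.norm_of_nonneg hr.le]
  refine ⟨?_, ?_, ?_, ?_, ?_, ?_⟩
  · intro x hx i hi
    have hd : ‖x - x₀‖ ≤ r 0 := by simpa [dist_eq_norm] using hA hx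
    have h := S.same 0 x hx x₀ hx₀ (by linarith) _ (hi.trans (by linarith))
    have h0 : linePerp (v 0 x₀) (x₀ - linePerp (v 0 x₀) (x₀ - p 0 x₀) +
        ((i : ℝ) * r 0) • v 0 x₀ - p 0 x₀) = 0 := by
      have : x₀ - linePerp (v 0 x₀) (x₀ - p 0 x₀) + ((i : ℝ) * r 0) • v 0 x₀ - p 0 x₀
        = (x₀ - p 0 x₀) - linePerp (v 0 x₀) (x₀ - p 0 x₀) + ((i : ℝ) * r 0) • v 0 x₀ := by abel
      rw [this, linePerp_add, linePerp_sub, linePerp_linePerp hu, linePerp_smul, linePerp_self hu]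
      simp
    rw [h0, norm_zero, zero_add] at h
    exact h
  · intro x _ i _
    simp only [step, hnorm]; simp
  · intro x _ i _
    have h1 := step (i - 1)
    simp only [sub_add_cancel] at h1
    simp only [step, h1]
    rw [real_inner_self_eq_norm_sq, hnorm]; positivity
  · intro i
    simp only [step, hnorm]; linarith
  · intro x hx
    refine ⟨0, ?_⟩
    have hd : ‖x₀ - x‖ ≤ r 0 := by simpa [dist_eq_norm, norm_sub_rev] using hA hx
    have hn := S.near 0 x₀ hx₀
    simp only [Int.cast_zero, zero_mul, zero_smul, add_zero]
    rw [sub_right_comm]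
    refine (norm_sub_le _ _).trans ?_
    linarith
  · intro i; simp

lemma LineSystem.exists_chainAt (S : LineSystem A r p v b) {x₀ : E} (hx₀ : x₀ ∈ A)
    (hA : A ⊆ closedBall x₀ (r 0)) : ∀ k, ∃ z : ℤ → E,
      ChainAt A r p v b (x₀ - linePerp (v 0 x₀) (x₀ - p 0 x₀)) (v 0 x₀) k z
  | 0 => ⟨_, S.chainAt_zero hx₀ hA⟩
  | k + 1 => by
    obtain ⟨z, hz⟩ := S.exists_chainAt hx₀ hA k
    exact ⟨_, hz.refine S⟩

lemma ChainAt.norm_sub_le_mul {q v₀ : E} {k : ℕ} {z : ℤ → E}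
    (Z : ChainAt A r p v b q v₀ k z) (i j : ℤ) :
    ‖z i - z j‖ ≤ 11 / 10 * |(i : ℝ) * r k - j * r k| := by
  wlog h : i ≤ j generalizing i j
  · rw [norm_sub_rev, abs_sub_comm]; exact this j i (by omega)
  obtain ⟨m, rfl⟩ := Int.le.dest h
  have key : ∀ m : ℕ, ‖z i - z (i + m)‖ ≤ 11 / 10 * (m * r k) := by
    intro m
    induction m with
    | zero => simp
    | succ m ih =>
      have h1 := Z.short (i + m)
      have h2 := norm_sub_le_norm_sub_add_norm_sub (z i) (z (i + m)) (z (i + m + 1))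
      rw [norm_sub_rev (z (i + m))] at h2
      push_cast
      rw [← add_assoc]
      linarith
  refine (key m).trans ?_
  push_cast
  rw [← sub_mul, sub_add_cancel_left, neg_mul, abs_neg]
  gcongr
  exact le_abs_self _

lemma LineSystem.r_eq (S : LineSystem A r p v b) (k : ℕ) : r k = r 0 * (1 / 2) ^ k := by
  induction k with
  | zero => simp
  | succ k ih => rw [S.r_succ, ih, pow_succ]; ring

/-- The set carrying a line system lies on a Lipschitz curve. -/
theorem LineSystem.exists_param (S : LineSystem A r p v b) {x₀ : E} (hx₀ : x₀ ∈ A)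
    (hA : A ⊆ closedBall x₀ (r 0)) :
    ∃ u : E → ℝ, (∀ x ∈ A, |u x| ≤ 10 * r 0) ∧
      ∀ x ∈ A, ∀ y ∈ A, ‖x - y‖ ≤ 11 / 10 * |u x - u y| := by
  choose z hz using S.exists_chainAt hx₀ hA
  set q := x₀ - linePerp (v 0 x₀) (x₀ - p 0 x₀) with hq
  have hidx : ∀ k x, ∃ i : ℤ, x ∈ A → ‖z k i - x‖ ≤ 3 * r k := by
    intro k x
    by_cases hx : x ∈ A
    · obtain ⟨i, hi⟩ := (hz k).cover x hx
      exact ⟨i, fun _ => hi⟩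
    · exact ⟨0, fun h => absurd h hx⟩
  choose i hi using hidx
  have hrk : ∀ k, r k ≤ r 0 := fun k => by
    rw [S.r_eq k]
    exact mul_le_of_le_one_right (S.r_pos 0).le (pow_le_one₀ (by norm_num) (by norm_num))
  have hr0 := S.r_pos 0
  have hbd : ∀ x ∈ A, ∀ k, |(i k x : ℝ) * r k| ≤ 10 * r 0 := by
    intro x hx k
    have h1 := hi k x hx
    have h2 := (hz k).drift (i k x)
    have h3 : ‖x - x₀‖ ≤ r 0 := by simpa [dist_eq_norm] using hA hx
    have h4 := S.near 0 x₀ hx₀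
    have h5 : ((i k x : ℝ) * r k) • v 0 x₀ = (x - x₀) + linePerp (v 0 x₀) (x₀ - p 0 x₀)
        + (z k (i k x) - x) - (z k (i k x) - (q + ((i k x : ℝ) * r k) • v 0 x₀)) := by
      rw [hq]; abel
    have h6 : ‖((i k x : ℝ) * r k) • v 0 x₀‖ = |(i k x : ℝ) * r k| := by
      rw [norm_smul, S.unit, mul_one, Real.norm_eq_abs]
    have h7 := hrk k
    have h8 := S.r_pos k
    rw [← h6, h5]
    refine (norm_sub_le _ _).trans ?_
    have := norm_add₃_le (a := x - x₀) (b := linePerp (v 0 x₀) (x₀ - p 0 x₀))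
      (c := z k (i k x) - x)
    linarith
  have hlim : ∀ x, ∃ a : ℝ, x ∈ A → |a| ≤ 10 * r 0 ∧
      Tendsto (fun k => (i k x : ℝ) * r k) (hyperfilter ℕ) (𝓝 a) := by
    intro x
    by_cases hx : x ∈ A
    · have hc : IsCompact (Icc (-(10 * r 0)) (10 * r 0)) := isCompact_Icc
      obtain ⟨a, ha, h⟩ := hc.ultrafilter_le_nhds ((hyperfilter ℕ).map fun k => (i k x : ℝ) * r k)
        (by
          rw [le_principal_iff]
          exact mem_map.mpr (univ_mem' fun k => abs_le.mp (hbd x hx k)))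
      exact ⟨a, fun _ => ⟨abs_le.mpr ha, h⟩⟩
    · exact ⟨0, fun h => absurd h hx⟩
  choose u hu using hlim
  refine ⟨u, fun x hx => (hu x hx).1, fun x hx y hy => ?_⟩
  have h1 : Tendsto (fun k => 6 * r k + 11 / 10 * |(i k x : ℝ) * r k - (i k y : ℝ) * r k|)
      (hyperfilter ℕ) (𝓝 (6 * 0 + 11 / 10 * |u x - u y|)) := by
    have hr : Tendsto r (hyperfilter ℕ) (𝓝 0) := by
      have : Tendsto r atTop (𝓝 (r 0 * 0)) := (tendsto_congr S.r_eq).mpr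
        ((tendsto_pow_atTop_nhds_zero_of_lt_one (r := (1 / 2 : ℝ)) (by norm_num)
          (by norm_num)).const_mul _)
      rw [mul_zero] at this
      exact this.mono_left Nat.hyperfilter_le_atTop
    exact (hr.const_mul _).add ((((hu x hx).2.sub (hu y hy).2).abs).const_mul _)
  rw [mul_zero, zero_add] at h1
  refine ge_of_tendsto h1 (Filter.Eventually.of_forall fun k => ?_)
  have h2 := hi k x hx
  have h3 := hi k y hy
  have h4 := (hz k).norm_sub_le_mul (i k x) (i k y)
  have h5 : x - y = (x - z k (i k x)) + (z k (i k x) - z k (i k y)) + (z k (i k y) - y) := by abel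
  rw [norm_sub_rev] at h2
  rw [h5]
  refine norm_add₃_le.trans ?_
  linarith

theorem LineSystem.exists_lipschitz [FiniteDimensional ℝ E] (S : LineSystem A r p v b) {x₀ : E}
    (hx₀ : x₀ ∈ A) (hA : A ⊆ closedBall x₀ (r 0)) :
    ∃ (R : ℝ) (C : ℝ≥0) (g : ℝ → E), LipschitzWith C g ∧ A ⊆ g '' Icc (-R) R := by
  obtain ⟨u, hu, huv⟩ := S.exists_param hx₀ hA
  have hinj : InjOn u A := fun x hx y hy h => by
    have := huv x hx y hy
    rw [h, sub_self, abs_zero, mul_zero] at this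
    exact sub_eq_zero.mp (norm_le_zero_iff.mp this)
  have : Nonempty E := ⟨x₀⟩
  have hl : LipschitzOnWith (11 / 10) (Function.invFunOn u A) (u '' A) := by
    refine LipschitzOnWith.of_dist_le_mul ?_
    rintro _ ⟨x, hx, rfl⟩ _ ⟨y, hy, rfl⟩
    rw [hinj.leftInvOn_invFunOn hx, hinj.leftInvOn_invFunOn hy, dist_eq_norm, Real.dist_eq]
    simpa using huv x hx y hy
  obtain ⟨g, hg, he⟩ := hl.extend_finite_dimension
  refine ⟨10 * r 0, _, g, hg, fun x hx => ⟨u x, abs_le.mp (hu x hx), ?_⟩⟩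
  rw [← he (mem_image_of_mem _ hx), hinj.leftInvOn_invFunOn hx]

end Limit

section Compare

variable {E : Type*} [NormedAddCommGroup E] [InnerProductSpace ℝ E]

lemma norm_linePerp_dir_le {v v' p p' w₁ w₂ : E} {η d : ℝ} (hv : ‖v‖ = 1) (hv' : ‖v'‖ = 1)
    (hd : 0 < d) (hηd : 4 * η ≤ d) (hw : d ≤ ‖w₁ - w₂‖)
    (h₁ : ‖linePerp v (w₁ - p)‖ ≤ η) (h₂ : ‖linePerp v (w₂ - p)‖ ≤ η)
    (h₁' : ‖linePerp v' (w₁ - p')‖ ≤ η) (h₂' : ‖linePerp v' (w₂ - p')‖ ≤ η) :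
    ‖linePerp v' v‖ ≤ 8 * η / d := by
  have a1 : ‖linePerp v (w₁ - w₂)‖ ≤ 2 * η := by
    rw [← sub_sub_sub_cancel_right _ _ p, linePerp_sub]
    exact (norm_sub_le _ _).trans (by linarith)
  have a2 : ‖linePerp v' (w₁ - w₂)‖ ≤ 2 * η := by
    rw [← sub_sub_sub_cancel_right _ _ p', linePerp_sub]
    exact (norm_sub_le _ _).trans (by linarith)
  have a3 := norm_le_inner_add_linePerp hv (w₁ - w₂)
  have a4 : |inner ℝ (w₁ - w₂) v| * ‖linePerp v' v‖ ≤ 4 * η := by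
    rw [← Real.norm_eq_abs, ← norm_smul, ← linePerp_smul]
    have : inner ℝ (w₁ - w₂) v • v = (w₁ - w₂) - linePerp v (w₁ - w₂) := by simp [linePerp]
    rw [this, linePerp_sub]
    refine (norm_sub_le _ _).trans ?_
    have := norm_linePerp_le hv' (linePerp v (w₁ - w₂))
    linarith
  rw [le_div_iff₀ hd]
  have : d / 2 * ‖linePerp v' v‖ ≤ |inner ℝ (w₁ - w₂) v| * ‖linePerp v' v‖ := by
    gcongr; linarith
  linarith

lemma norm_linePerp_point_le {v v' p p' w : E} {η a R : ℝ} (hv : ‖v‖ = 1) (hv' : ‖v'‖ = 1)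
    (h : ‖linePerp v (w - p)‖ ≤ η) (h' : ‖linePerp v' (w - p')‖ ≤ η) (ha : ‖linePerp v' v‖ ≤ a)
    {z : E} (hz : ‖z - w‖ ≤ R) :
    ‖linePerp v' (z - p')‖ ≤ ‖linePerp v (z - p)‖ + 2 * η + R * a := by
  have e1 : z - p' = (w - p') + (z - w) := by abel
  have e2 : z - w = linePerp v (z - w) + inner ℝ (z - w) v • v := (linePerp_add_inner_smul _ _).symm
  have e3 : z - w = (z - p) - (w - p) := by abel
  have h1 : ‖linePerp v (z - w)‖ ≤ ‖linePerp v (z - p)‖ + η := by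
    rw [e3, linePerp_sub]; exact (norm_sub_le _ _).trans (by linarith)
  have h2 : ‖linePerp v' (z - w)‖ ≤ ‖linePerp v (z - w)‖ + R * a := by
    conv_lhs => rw [e2]
    refine (norm_linePerp_add_le _ _ _).trans ?_
    rw [linePerp_smul, norm_smul, Real.norm_eq_abs]
    have h3 := norm_linePerp_le hv' (linePerp v (z - w))
    have h4 : |inner ℝ (z - w) v| * ‖linePerp v' v‖ ≤ R * a :=
      mul_le_mul ((abs_inner_unit_le hv _).trans hz) ha (norm_nonneg _)
        ((norm_nonneg _).trans hz)
    linarith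
  rw [e1]
  refine (norm_linePerp_add_le _ _ _).trans ?_
  linarith

end Compare

section LineErr

variable {E : Type*} [NormedAddCommGroup E] [InnerProductSpace ℝ E] [MeasurableSpace E]

/-- The squared `L²` distance of `μ` in the ball to the line through `p` with direction `v`. -/
def lineErr (μ : Measure E) (x : E) (ρ : ℝ) (p v : E) : ℝ≥0∞ :=
  ∫⁻ y in closedBall x ρ, ENNReal.ofReal (‖linePerp v (y - p)‖ ^ 2) ∂μ

/-- The least squared `L²` distance of `μ` in the ball to a line. -/
def ballErr (μ : Measure E) (x : E) (ρ : ℝ) : ℝ≥0∞ :=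
  ⨅ (p : E) (v : E) (_ : ‖v‖ = 1), lineErr μ x ρ p v

variable {μ : Measure E}

lemma lineErr_mono {x y : E} {ρ σ : ℝ} (h : closedBall x ρ ⊆ closedBall y σ) (p v : E) :
    lineErr μ x ρ p v ≤ lineErr μ y σ p v :=
  lintegral_mono_set h

lemma ballErr_mono {x y : E} {ρ σ : ℝ} (h : closedBall x ρ ⊆ closedBall y σ) :
    ballErr μ x ρ ≤ ballErr μ y σ :=
  iInf_mono fun p => iInf_mono fun v => iInf_mono fun _ => lineErr_mono h p v

lemma exists_lineErr_le [Nontrivial E] {x : E} {ρ : ℝ} {ε : ℝ} (hε : 0 < ε)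
    (h : ballErr μ x ρ ≠ ⊤) :
    ∃ p v, ‖v‖ = 1 ∧ lineErr μ x ρ p v ≤ ballErr μ x ρ + ENNReal.ofReal ε := by
  have := ENNReal.lt_add_right h (ENNReal.ofReal_pos.mpr hε).ne'
  rw [ballErr] at this
  simp only [iInf_lt_iff] at this
  obtain ⟨p, v, hv, hlt⟩ := this
  exact ⟨p, v, hv, hlt.le⟩

variable [BorelSpace E]

lemma measurable_linePerp_sq (p v : E) :
    Measurable fun y : E => ENNReal.ofReal (‖linePerp v (y - p)‖ ^ 2) := by
  refine ENNReal.measurable_ofReal.comp (Continuous.measurable ?_)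
  unfold linePerp
  fun_prop

/-- A subset of large mass of a ball contains a point close to a given line. -/
lemma exists_near_two_lines {F : Set E} {x : E} {ρ m θ : ℝ} (hF : F ⊆ closedBall x ρ) (hm : 0 < m)
    (hμ : ENNReal.ofReal m ≤ μ F) (hμ' : μ F ≠ ⊤) {p v p' v' : E} (hθ : 0 ≤ θ)
    (h : lineErr μ x ρ p v ≤ ENNReal.ofReal θ) (h' : lineErr μ x ρ p' v' ≤ ENNReal.ofReal θ) :
    ∃ w ∈ F, ‖linePerp v (w - p)‖ ≤ √(2 * θ / m) ∧ ‖linePerp v' (w - p')‖ ≤ √(2 * θ / m) := by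
  have hm' : 0 < ENNReal.ofReal m := ENNReal.ofReal_pos.mpr hm
  obtain ⟨w, hw, hle⟩ := exists_le_setLAverage (hm'.trans_le hμ).ne' hμ'
    ((measurable_linePerp_sq p v).add (measurable_linePerp_sq p' v')).aemeasurable
  have h1 : ENNReal.ofReal (‖linePerp v (w - p)‖ ^ 2 + ‖linePerp v' (w - p')‖ ^ 2)
      ≤ ENNReal.ofReal (2 * θ / m) := by
    rw [ENNReal.ofReal_add (by positivity) (by positivity)]
    refine hle.trans ?_
    rw [setLAverage_eq, ENNReal.ofReal_div_of_pos hm]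
    refine ENNReal.div_le_div ?_ hμ
    simp only [Pi.add_apply]
    rw [lintegral_add_left (measurable_linePerp_sq p v), two_mul, ENNReal.ofReal_add hθ hθ]
    exact add_le_add ((lintegral_mono_set hF).trans h) ((lintegral_mono_set hF).trans h')
  rw [ENNReal.ofReal_le_ofReal_iff (by positivity)] at h1
  refine ⟨w, hw, Real.le_sqrt_of_sq_le ?_, Real.le_sqrt_of_sq_le ?_⟩ <;>
    nlinarith [sq_nonneg ‖linePerp v (w - p)‖, sq_nonneg ‖linePerp v' (w - p')‖]

/-- Two lines which both approximate a measure with `1`-dimensional growth are close. -/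
lemma exists_line_compare {c C : ℝ} (hc : 0 < c) (hcC : c ≤ C) :
    ∃ D > 0, ∃ s₀ > 0, ∀ (μ : Measure E) (y : E) (ρ : ℝ), 0 < ρ →
      (∀ σ, 0 < σ → σ ≤ ρ → ENNReal.ofReal (c * σ) ≤ μ (closedBall y σ) ∧
        μ (closedBall y σ) ≤ ENNReal.ofReal (C * σ)) →
      ∀ p v p' v' : E, ‖v‖ = 1 → ‖v'‖ = 1 → ∀ s, 0 ≤ s → s ≤ s₀ →
      lineErr μ y ρ p v ≤ ENNReal.ofReal (s ^ 2 * ρ ^ 3) →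
      lineErr μ y ρ p' v' ≤ ENNReal.ofReal (s ^ 2 * ρ ^ 3) →
      ‖linePerp v' v‖ ≤ D * s ∧ ∀ z, ‖z - y‖ ≤ 100 * ρ →
        ‖linePerp v' (z - p')‖ ≤ ‖linePerp v (z - p)‖ + D * s * ρ := by
  have hC : 0 < C := hc.trans_le hcC
  obtain ⟨δ, hδ, hδ1, hCδ⟩ : ∃ δ : ℝ, 0 < δ ∧ δ ≤ 1 / 2 ∧ C * δ = c / 2 := by
    refine ⟨c / (2 * C), by positivity, ?_, by field_simp⟩
    rw [div_le_iff₀ (by positivity)]; linarith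
  set m := c * δ / 2 with hm
  have hm0 : 0 < m := by positivity
  set κ := √(2 / m) with hκ
  have hκ0 : 0 < κ := by positivity
  refine ⟨2 * κ + 101 * (16 * κ / δ) + 16 * κ / δ, by positivity, δ / (8 * κ), by positivity, ?_⟩
  intro μ y ρ hρ hμ p v p' v' hv hv' s hs hs0 h h'
  have hη : √(2 * (s ^ 2 * ρ ^ 3) / (m * ρ)) = κ * s * ρ := by
    rw [show 2 * (s ^ 2 * ρ ^ 3) / (m * ρ) = 2 / m * (s * ρ) ^ 2 by field_simp,
      Real.sqrt_mul (by positivity), Real.sqrt_sq (by positivity), mul_assoc]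
  have hfin : μ (closedBall y ρ) ≠ ⊤ := ((hμ ρ hρ le_rfl).2.trans_lt ENNReal.ofReal_lt_top).ne
  have sub1 : closedBall y (δ / 2 * ρ) ⊆ closedBall y ρ := closedBall_subset_closedBall (by nlinarith)
  have sub2 : closedBall y (δ * ρ) ⊆ closedBall y ρ := closedBall_subset_closedBall (by nlinarith)
  obtain ⟨w₁, hw₁, a₁, a₁'⟩ := exists_near_two_lines (μ := μ) (F := closedBall y (δ / 2 * ρ))
    (m := m * ρ) sub1 (by positivity)
    ((ENNReal.ofReal_le_ofReal (by rw [hm]; linarith)).trans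
      (hμ (δ / 2 * ρ) (by positivity) (by nlinarith)).1)
    (measure_ne_top_of_subset sub1 hfin) (by positivity) h h'
  obtain ⟨w₂, hw₂, a₂, a₂'⟩ := exists_near_two_lines (μ := μ)
    (F := closedBall y ρ \ closedBall y (δ * ρ))
    (m := m * ρ) sdiff_subset (by positivity)
    (by
      rw [measure_sdiff sub2 measurableSet_closedBall.nullMeasurableSet
        (measure_ne_top_of_subset sub2 hfin)]
      have h1 := (hμ ρ hρ le_rfl).1
      have h2 := (hμ (δ * ρ) (by positivity) (by nlinarith)).2
      refine le_trans ?_ (tsub_le_tsub h1 h2)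
      rw [← ENNReal.ofReal_sub _ (by positivity)]
      refine ENNReal.ofReal_le_ofReal ?_
      rw [← mul_assoc, hCδ, hm]
      nlinarith [mul_pos hc hρ])
    (measure_ne_top_of_subset sdiff_subset hfin) (by positivity) h h'
  rw [hη] at a₁ a₁' a₂ a₂'
  have n1 : ‖w₁ - y‖ ≤ δ / 2 * ρ := by simpa [dist_eq_norm] using hw₁
  have n2 : δ * ρ < ‖w₂ - y‖ := by simpa [dist_eq_norm] using hw₂.2
  have hw : δ / 2 * ρ ≤ ‖w₁ - w₂‖ := by
    have := norm_sub_le_norm_sub_add_norm_sub w₂ w₁ y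
    rw [norm_sub_rev w₂ w₁] at this
    linarith
  have hs1 : κ * s * 8 ≤ δ := by
    rw [le_div_iff₀ (by positivity)] at hs0; linarith
  have hdir := norm_linePerp_dir_le hv hv' (by positivity) (by nlinarith) hw a₁ a₂ a₁' a₂'
  have he : 8 * (κ * s * ρ) / (δ / 2 * ρ) = 16 * κ / δ * s := by field_simp; ring
  rw [he] at hdir
  constructor
  · refine hdir.trans ?_
    gcongr
    have : 0 ≤ 2 * κ + 101 * (16 * κ / δ) := by positivity
    linarith
  · intro z hz
    have hzw : ‖z - w₁‖ ≤ 101 * ρ := by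
      have := norm_sub_le_norm_sub_add_norm_sub z y w₁
      rw [norm_sub_rev y w₁] at this
      nlinarith
    have := norm_linePerp_point_le hv hv' a₁ a₁' hdir hzw
    refine this.trans ?_
    have : 0 ≤ 16 * κ / δ * s * ρ := by positivity
    linarith

lemma norm_linePerp_center_le {x : E} {ρ c s : ℝ} (hc : 0 < c) (hρ : 0 < ρ) {p v : E}
    (hv : ‖v‖ = 1) (hs : 400 * 200 ^ 2 * s ^ 2 ≤ c)
    (hμ : ENNReal.ofReal (c * (ρ / 200)) ≤ μ (closedBall x (ρ / 200)))
    (hμ' : μ (closedBall x (ρ / 200)) ≠ ⊤)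
    (h : lineErr μ x ρ p v ≤ ENNReal.ofReal (s ^ 2 * ρ ^ 3)) :
    ‖linePerp v (x - p)‖ ≤ ρ / 100 := by
  obtain ⟨w, hw, h1, -⟩ := exists_near_two_lines (F := closedBall x (ρ / 200))
    (m := c * (ρ / 200)) (closedBall_subset_closedBall (by linarith)) (by positivity) hμ hμ'
    (by positivity) h h
  have h2 : √(2 * (s ^ 2 * ρ ^ 3) / (c * (ρ / 200))) ≤ ρ / 200 := by
    rw [Real.sqrt_le_left (by positivity), div_le_iff₀ (by positivity)]
    have : 0 < ρ ^ 3 := by positivity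
    nlinarith
  have h3 : ‖w - x‖ ≤ ρ / 200 := by simpa [dist_eq_norm] using hw
  have h4 := norm_linePerp_le hv (w - x)
  have : x - p = (w - p) - (w - x) := by abel
  rw [this, linePerp_sub]
  refine (norm_sub_le _ _).trans ?_
  linarith

end LineErr

section System

variable {E : Type*} [NormedAddCommGroup E] [InnerProductSpace ℝ E] [MeasurableSpace E]
  [BorelSpace E]

lemma exists_lineSystem [Nontrivial E] {c C : ℝ} (hc : 0 < c) (hcC : c ≤ C) :
    ∃ ε > 0, ∀ (μ : Measure E) (A : Set E) (r₀ : ℝ), 0 < r₀ →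
      (∀ x ∈ A, ∀ σ, 0 < σ → σ ≤ r₀ → ENNReal.ofReal (c * σ) ≤ μ (closedBall x σ) ∧
        μ (closedBall x σ) ≤ ENNReal.ofReal (C * σ)) →
      (∀ x ∈ A, ∑' k : ℕ, ballErr μ x (256 * (r₀ * (1 / 2) ^ k)) /
        ENNReal.ofReal ((r₀ * (1 / 2) ^ k) ^ 3) ≤ ENNReal.ofReal ε) →
      ∃ p v b, LineSystem A (fun k => r₀ * (1 / 2) ^ k) p v b := by
  obtain ⟨D, hD, s₀, hs₀, hcomp⟩ := exists_line_compare (E := E) hc hcC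
  set ε := min (s₀ ^ 2) (min (1 / (10000 * D ^ 2)) (c / (400 * 200 ^ 2))) / 2 with hε
  have hε0 : 0 < ε := by positivity
  have hε1 : 2 * ε ≤ s₀ ^ 2 := by
    rw [hε, mul_div_cancel₀ _ two_ne_zero]; exact min_le_left _ _
  have hε2 : 2 * ε ≤ 1 / (10000 * D ^ 2) := by
    rw [hε, mul_div_cancel₀ _ two_ne_zero]; exact (min_le_right _ _).trans (min_le_left _ _)
  have hε3 : 2 * ε ≤ c / (400 * 200 ^ 2) := by
    rw [hε, mul_div_cancel₀ _ two_ne_zero]; exact (min_le_right _ _).trans (min_le_right _ _)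
  refine ⟨ε, hε0, fun μ A r₀ hr₀ hμ hsum => ?_⟩
  set r : ℕ → ℝ := fun k => r₀ * (1 / 2) ^ k with hr
  have hrpos : ∀ k, 0 < r k := fun k => by simp only [hr]; positivity
  have hrsucc : ∀ k, r (k + 1) = r k / 2 := fun k => by simp only [hr, pow_succ]; ring
  have hrle : ∀ k, r k ≤ r₀ := fun k =>
    mul_le_of_le_one_right hr₀.le (pow_le_one₀ (by norm_num) (by norm_num))
  have hfin : ∀ x ∈ A, ∀ k, ballErr μ x (256 * r k) ≠ ⊤ := by
    intro x hx k htop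
    have := (ENNReal.le_tsum k).trans (hsum x hx)
    rw [htop, ENNReal.top_div_of_ne_top ENNReal.ofReal_ne_top] at this
    exact ENNReal.ofReal_ne_top (top_le_iff.mp this)
  have hfin' : ∀ x ∈ A, ∀ k, ballErr μ x (128 * r k) ≠ ⊤ := fun x hx k =>
    ne_top_of_le_ne_top (hfin x hx k)
      (ballErr_mono (closedBall_subset_closedBall (by linarith [hrpos k])))
  set τ : ℕ → ℝ := fun k => ε / 2 * (1 / 2) ^ k with hτ
  have hτpos : ∀ k, 0 < τ k := fun k => by positivity
  have hτsucc : ∀ k, τ (k + 1) ≤ τ k := fun k => by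
    have := hτpos k
    simp only [hτ, pow_succ] at *; linarith
  have hlines : ∀ k x, ∃ p v : E, ‖v‖ = 1 ∧ (x ∈ A → lineErr μ x (128 * r k) p v ≤
      ballErr μ x (128 * r k) + ENNReal.ofReal (τ k * r k ^ 3)) := by
    intro k x
    by_cases hx : x ∈ A
    · obtain ⟨p, v, hv, h⟩ := exists_lineErr_le (ε := τ k * r k ^ 3)
        (mul_pos (hτpos k) (pow_pos (hrpos k) 3)) (hfin' x hx k)
      exact ⟨p, v, hv, fun _ => h⟩
    · obtain ⟨v, hv⟩ := exists_norm_eq E (zero_le_one (α := ℝ))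
      exact ⟨0, v, hv, fun h => absurd h hx⟩
  choose p v hv hpv using hlines
  set θ : ℕ → E → ℝ := fun k x => (ballErr μ x (256 * r k)).toReal / r k ^ 3 + τ k with hθ
  have hθ0 : ∀ k x, 0 ≤ θ k x := fun k x => by
    have := hτpos k; have := hrpos k; simp only [hθ]; positivity
  have hθr : ∀ k, ∀ x ∈ A, ballErr μ x (256 * r k) + ENNReal.ofReal (τ k * r k ^ 3) =
      ENNReal.ofReal (√(θ k x) ^ 2 * r k ^ 3) := by
    intro k x hx
    have := hτpos k
    have := hrpos k
    rw [Real.sq_sqrt (hθ0 k x), hθ]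
    simp only
    rw [add_mul, div_mul_cancel₀ _ (by positivity), ENNReal.ofReal_add (by positivity)
      (by positivity), ENNReal.ofReal_toReal (hfin x hx k)]
  have herr : ∀ k, ∀ x ∈ A, ∀ y ∈ A, ‖x - y‖ ≤ 50 * r k →
      lineErr μ y (r k) (p k y) (v k y) ≤ ENNReal.ofReal (√(θ k x) ^ 2 * r k ^ 3) ∧
      lineErr μ y (r k) (p k x) (v k x) ≤ ENNReal.ofReal (√(θ k x) ^ 2 * r k ^ 3) ∧
      lineErr μ y (r k) (p (k + 1) y) (v (k + 1) y) ≤ ENNReal.ofReal (√(θ k x) ^ 2 * r k ^ 3) := by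
    intro k x hx y hy hxy
    have hk := hrpos k
    rw [← hθr k x hx]
    rw [← dist_eq_norm] at hxy
    have hyx : dist y x ≤ 50 * r k := by rwa [dist_comm]
    refine ⟨?_, ?_, ?_⟩
    · refine (lineErr_mono (closedBall_subset_closedBall (by linarith)) _ _).trans
        ((hpv k y hy).trans ?_)
      gcongr
      exact ballErr_mono (closedBall_subset_closedBall' (by linarith))
    · refine (lineErr_mono (closedBall_subset_closedBall' (by linarith)) _ _).trans
        ((hpv k x hx).trans ?_)
      gcongr
      exact ballErr_mono (closedBall_subset_closedBall (by linarith))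
    · refine (lineErr_mono (closedBall_subset_closedBall (by rw [hrsucc]; linarith)) _ _).trans
        ((hpv (k + 1) y hy).trans ?_)
      gcongr
      · exact ballErr_mono (closedBall_subset_closedBall' (by rw [hrsucc]; linarith))
      · exact hτsucc k
      · rw [hrsucc]; linarith
  have hsum' : ∀ x ∈ A, ∀ k, ∑ j ∈ Finset.range k, θ j x ≤ 2 * ε := by
    intro x hx k
    simp only [hθ]
    rw [Finset.sum_add_distrib]
    have h1 : ∑ j ∈ Finset.range k, τ j ≤ ε := by
      simp only [hτ]
      rw [← Finset.mul_sum]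
      have := Summable.sum_le_tsum (f := fun j : ℕ => (1 / 2 : ℝ) ^ j) (Finset.range k)
        (fun _ _ => by positivity) summable_geometric_two
      rw [tsum_geometric_two] at this
      nlinarith
    have h2 : ∑ j ∈ Finset.range k, (ballErr μ x (256 * r j)).toReal / r j ^ 3 ≤ ε := by
      have h3 := (ENNReal.sum_le_tsum (Finset.range k)).trans (hsum x hx)
      have h4 := ENNReal.toReal_mono ENNReal.ofReal_ne_top h3
      rw [ENNReal.toReal_ofReal hε0.le, ENNReal.toReal_sum] at h4
      · refine le_trans (Finset.sum_le_sum fun j _ => ?_) h4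
        rw [ENNReal.toReal_div, ENNReal.toReal_ofReal (pow_pos (hrpos j) 3).le]
      · intro j _
        exact ENNReal.div_ne_top (hfin x hx j) (ENNReal.ofReal_pos.mpr (pow_pos (hrpos j) 3)).ne'
    linarith
  have hθle : ∀ x ∈ A, ∀ k, θ k x ≤ 2 * ε := fun x hx k =>
    (Finset.single_le_sum (f := fun j => θ j x) (fun j _ => hθ0 j x)
      (Finset.self_mem_range_succ k)).trans (hsum' x hx (k + 1))
  have hsle : ∀ x ∈ A, ∀ k, √(θ k x) ≤ s₀ := fun x hx k =>
    (Real.sqrt_le_left hs₀.le).mpr ((hθle x hx k).trans hε1)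
  have hball : ∀ k, ∀ y ∈ A, ∀ σ, 0 < σ → σ ≤ r k → ENNReal.ofReal (c * σ) ≤ μ (closedBall y σ) ∧
        μ (closedBall y σ) ≤ ENNReal.ofReal (C * σ) := fun k y hy σ h1 h2 =>
    hμ y hy σ h1 (h2.trans (hrle k))
  have hz100 : ∀ {k : ℕ} {x y z : E}, ‖x - y‖ ≤ 50 * r k → ‖z - x‖ ≤ 50 * r k →
      ‖z - y‖ ≤ 100 * r k := fun {k x y z} h1 h2 => by
    have := norm_sub_le_norm_sub_add_norm_sub z x y
    linarith
  refine ⟨p, v, fun k x => D * √(θ k x), hrpos, hrsucc, hv,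
    fun k x => by positivity, ?_, ?_, ?_, ?_, ?_⟩
  · intro k x hx
    have hk := hrpos k
    have h1 := hμ x hx (r k / 200) (by positivity) (by linarith [hrle k])
    refine norm_linePerp_center_le hc hk (hv k x) ?_ h1.1
      (h1.2.trans_lt ENNReal.ofReal_lt_top).ne (herr k x hx x hx (by simp; positivity)).1
    rw [Real.sq_sqrt (hθ0 k x)]
    have := (hθle x hx k).trans hε3
    rw [le_div_iff₀ (by positivity)] at this
    linarith
  · intro k x hx y hy hxy
    obtain ⟨-, h1, h2⟩ := herr k x hx y hy hxy
    exact (hcomp μ y (r k) (hrpos k) (hball k y hy) _ _ _ _ (hv _ _) (hv _ _) _ (Real.sqrt_nonneg _)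
      (hsle x hx k) h1 h2).1
  · intro k x hx y hy hxy z hz
    obtain ⟨-, h1, h2⟩ := herr k x hx y hy hxy
    exact (hcomp μ y (r k) (hrpos k) (hball k y hy) _ _ _ _ (hv _ _) (hv _ _) _ (Real.sqrt_nonneg _)
      (hsle x hx k) h1 h2).2 z (hz100 hxy hz)
  · intro k x hx y hy hxy z hz
    obtain ⟨h1, h2, -⟩ := herr k x hx y hy hxy
    exact (hcomp μ y (r k) (hrpos k) (hball k y hy) _ _ _ _ (hv _ _) (hv _ _) _ (Real.sqrt_nonneg _)
      (hsle x hx k) h1 h2).2 z (hz100 hxy hz)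
  · intro k x hx
    simp only [mul_pow, Real.sq_sqrt (hθ0 _ x)]
    rw [← Finset.mul_sum]
    have h1 := (hsum' x hx k).trans hε2
    rw [le_div_iff₀ (by positivity)] at h1
    rw [le_div_iff₀ (by positivity)]
    linarith

/-- A set of points with `1`-dimensional mass bounds and summable flatness is covered by countably
many Lipschitz curves. -/
theorem exists_lipschitz_cover [FiniteDimensional ℝ E] [Nontrivial E] {μ : Measure E} {A : Set E}
    (hlow : ∀ x ∈ A, ∃ c > 0, ∀ σ, 0 < σ → σ ≤ 1 → ENNReal.ofReal (c * σ) ≤ μ (closedBall x σ))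
    (hup : ∀ x ∈ A, ∃ C, ∀ σ, 0 < σ → σ ≤ 1 → μ (closedBall x σ) ≤ ENNReal.ofReal (C * σ))
    (hsum : ∀ x ∈ A, ∑' k : ℕ, ENNReal.ofReal (8 ^ k) * ballErr μ x ((1 / 2) ^ k) ≠ ⊤) :
    ∃ (R : ℕ → ℝ) (C : ℕ → ℝ≥0) (g : ℕ → ℝ → E), (∀ i, LipschitzWith (C i) (g i)) ∧
      A ⊆ ⋃ i, g i '' Icc (-(R i)) (R i) := by
  have hm : ∀ m : ℕ, (0 : ℝ) < 1 / (m + 1) ∧ (1 : ℝ) / (m + 1) ≤ m + 1 := fun m => by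
    have : (0 : ℝ) ≤ m := m.cast_nonneg
    refine ⟨by positivity, ?_⟩
    rw [div_le_iff₀ (by positivity)]; nlinarith
  choose ε hε hsys using fun m : ℕ => exists_lineSystem (E := E) (hm m).1 (hm m).2
  set r₀ : ℕ → ℝ := fun j => (1 / 2) ^ (j + 8) with hr₀
  have hr₀pos : ∀ j, 0 < r₀ j := fun j => by positivity
  have hr₀le : ∀ j, r₀ j ≤ 1 := fun j => pow_le_one₀ (by norm_num) (by norm_num)
  set d := TopologicalSpace.denseSeq E
  have hterm : ∀ (j k : ℕ) (x : E), ballErr μ x (256 * (r₀ j * (1 / 2) ^ k)) /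
      ENNReal.ofReal ((r₀ j * (1 / 2) ^ k) ^ 3) =
      ENNReal.ofReal (8 ^ 8) * (ENNReal.ofReal (8 ^ (k + j)) * ballErr μ x ((1 / 2) ^ (k + j))) := by
    intro j k x
    have e1 : 256 * (r₀ j * (1 / 2) ^ k) = (1 / 2) ^ (k + j) := by
      simp only [hr₀, pow_add]; ring
    have e2 : ((r₀ j * (1 / 2) ^ k) ^ 3)⁻¹ = 8 ^ 8 * 8 ^ (k + j) := by
      have : r₀ j * (1 / 2) ^ k = ((2 : ℝ) ^ (j + 8 + k))⁻¹ := by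
        simp only [hr₀]; rw [← pow_add, one_div, inv_pow]
      rw [this, inv_pow, inv_inv, ← pow_mul, mul_comm, pow_mul, show (2 : ℝ) ^ 3 = 8 by norm_num]
      ring
    rw [e1, div_eq_mul_inv, ← ENNReal.ofReal_inv_of_pos (by have := hr₀pos j; positivity), e2,
      ENNReal.ofReal_mul (by positivity), mul_comm, mul_assoc]
  let B : ℕ × ℕ × ℕ → Set E := fun q => {x ∈ A ∩ closedBall (d q.2.2) (r₀ q.2.1 / 2) |
    (∀ σ, 0 < σ → σ ≤ r₀ q.2.1 → ENNReal.ofReal (1 / (q.1 + 1) * σ) ≤ μ (closedBall x σ) ∧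
        μ (closedBall x σ) ≤ ENNReal.ofReal ((q.1 + 1) * σ)) ∧
    ∑' k : ℕ, ballErr μ x (256 * (r₀ q.2.1 * (1 / 2) ^ k)) /
        ENNReal.ofReal ((r₀ q.2.1 * (1 / 2) ^ k) ^ 3) ≤ ENNReal.ofReal (ε q.1)}
  have hB : ∀ q, ∃ (R : ℝ) (C : ℝ≥0) (g : ℝ → E), LipschitzWith C g ∧ B q ⊆ g '' Icc (-R) R := by
    intro q
    rcases (B q).eq_empty_or_nonempty with h | ⟨x₀, hx₀⟩
    · exact ⟨0, 0, fun _ => 0, LipschitzWith.const _, by rw [h]; exact empty_subset _⟩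
    · obtain ⟨p, v, b, S⟩ := hsys q.1 μ (B q) (r₀ q.2.1) (hr₀pos _) (fun x hx => hx.2.1)
        (fun x hx => hx.2.2)
      refine S.exists_lipschitz hx₀ fun x hx => ?_
      have h1 := mem_closedBall.mp hx.1.2
      have h2 := mem_closedBall.mp hx₀.1.2
      rw [mem_closedBall]
      refine (dist_triangle_right _ _ (d q.2.2)).trans ?_
      simp only [pow_zero, mul_one]; linarith
  have hAB : A ⊆ ⋃ q, B q := by
    intro x hx
    obtain ⟨c, hc, hc'⟩ := hlow x hx
    obtain ⟨C, hC'⟩ := hup x hx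
    obtain ⟨m₁, hm₁⟩ := exists_nat_one_div_lt hc
    obtain ⟨m₂, hm₂⟩ := exists_nat_gt C
    set m := max m₁ m₂
    have hm1 : (1 : ℝ) / (m + 1) ≤ c := by
      refine le_trans ?_ hm₁.le
      gcongr; exact le_max_left _ _
    have hm2 : C ≤ m + 1 := by
      have : (m₂ : ℝ) ≤ m := by exact_mod_cast le_max_right _ _
      linarith
    obtain ⟨j, hj⟩ : ∃ j : ℕ, ENNReal.ofReal (8 ^ 8) * ∑' k : ℕ, ENNReal.ofReal (8 ^ (k + j)) *
        ballErr μ x ((1 / 2) ^ (k + j)) ≤ ENNReal.ofReal (ε m) := by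
      have h1 := ENNReal.Tendsto.const_mul (a := ENNReal.ofReal (8 ^ 8))
        (ENNReal.tendsto_sum_nat_add _ (hsum x hx)) (Or.inr ENNReal.ofReal_ne_top)
      rw [mul_zero] at h1
      obtain ⟨j, hj⟩ := (h1.eventually (ge_mem_nhds (ENNReal.ofReal_pos.mpr (hε m)))).exists
      exact ⟨j, hj⟩
    obtain ⟨i, hi⟩ := (TopologicalSpace.denseRange_denseSeq E).exists_dist_lt x
      (half_pos (hr₀pos j))
    refine mem_iUnion.mpr ⟨(m, j, i), ⟨⟨hx, mem_closedBall.mpr hi.le⟩, ?_, ?_⟩⟩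
    · intro σ h1 h2
      have h3 := h2.trans (hr₀le j)
      exact ⟨(ENNReal.ofReal_le_ofReal (by gcongr)).trans (hc' σ h1 h3),
        (hC' σ h1 h3).trans (ENNReal.ofReal_le_ofReal (by gcongr))⟩
    · simp only [hterm]
      rw [ENNReal.tsum_mul_left]
      exact hj
  choose R C g hg hBg using hB
  obtain ⟨e⟩ : Nonempty (ℕ ≃ ℕ × ℕ × ℕ) := ⟨(Denumerable.eqv (ℕ × ℕ × ℕ)).symm⟩
  refine ⟨fun i => R (e i), fun i => C (e i), fun i => g (e i), fun i => hg _, fun x hx => ?_⟩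
  obtain ⟨q, hq⟩ := mem_iUnion.mp (hAB hx)
  refine mem_iUnion.mpr ⟨e.symm q, ?_⟩
  simp only [e.apply_symm_apply]
  exact hBg q hq

end System

section Density

variable {X : Type*} [PseudoMetricSpace X] [SecondCountableTopology X] [MeasurableSpace X]
  [BorelSpace X]

lemma exists_cover_of_large_density (μ : Measure X) [IsFiniteMeasure μ] {N : Set X} {C : ℝ}
    (hC : 0 < C)
    (hN : ∀ x ∈ N, ∃ r > 0, ENNReal.ofReal (C * r) < μ (closedBall x r)) :
    ∃ (u : Set X) (r : X → ℝ), u.Countable ∧ (∀ x ∈ u, 0 < r x ∧ r x ≤ (μ univ).toReal / C) ∧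
      N ⊆ ⋃ x ∈ u, closedBall x (5 * r x) ∧
      ∑' x : u, ENNReal.ofReal (r x) ≤ μ univ / ENNReal.ofReal C := by
  have : ∀ x, ∃ r : ℝ, x ∈ N → 0 < r ∧ ENNReal.ofReal (C * r) < μ (closedBall x r) := by
    intro x
    by_cases hx : x ∈ N
    · obtain ⟨r, h⟩ := hN x hx; exact ⟨r, fun _ => h⟩
    · exact ⟨0, fun h => absurd h hx⟩
  choose r hr using this
  have hle : ∀ x ∈ N, r x ≤ (μ univ).toReal / C := by
    intro x hx
    rw [le_div_iff₀ hC, mul_comm]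
    have h := (hr x hx).2.le.trans (measure_mono (subset_univ _))
    rwa [ENNReal.ofReal_le_iff_le_toReal (measure_ne_top _ _)] at h
  obtain ⟨u, huN, hdisj, hcov⟩ := Vitali.exists_disjoint_subfamily_covering_enlargement_closedBall N
    (fun x => x) r _ hle 5 (by norm_num)
  have hcount : u.Countable := hdisj.countable_of_nonempty_interior fun x hx =>
    ⟨x, ball_subset_interior_closedBall (mem_ball_self (hr x (huN hx)).1)⟩
  refine ⟨u, r, hcount, fun x hx => ⟨(hr x (huN hx)).1, hle x (huN hx)⟩, fun x hx => ?_, ?_⟩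
  · obtain ⟨y, hy, hsub⟩ := hcov x hx
    exact mem_iUnion₂.mpr ⟨y, hy, hsub (mem_closedBall_self (hr x hx).1.le)⟩
  · have := hcount.to_subtype
    rw [ENNReal.le_div_iff_mul_le (Or.inl (ENNReal.ofReal_pos.mpr hC).ne')
      (Or.inl ENNReal.ofReal_ne_top), ← ENNReal.tsum_mul_right]
    calc ∑' x : u, ENNReal.ofReal (r x) * ENNReal.ofReal C
        ≤ ∑' x : u, μ (closedBall (x : X) (r x)) := by
          refine ENNReal.tsum_le_tsum fun x => ?_
          rw [← ENNReal.ofReal_mul (hr x (huN x.2)).1.le, mul_comm]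
          exact (hr x (huN x.2)).2.le
      _ ≤ μ (⋃ x : u, closedBall (x : X) (r x)) :=
          tsum_meas_le_meas_iUnion_of_disjoint _ (fun _ => measurableSet_closedBall)
            (hdisj.subtype _ _)
      _ ≤ μ univ := measure_mono (subset_univ _)

end Density

section Hausdorff

variable {X : Type*} [MetricSpace X] [SecondCountableTopology X] [MeasurableSpace X] [BorelSpace X]

/-- A set of infinite upper `1`-density for a finite measure has vanishing length. -/
theorem hausdorffMeasure_eq_zero_of_large_density (μ : Measure X) [IsFiniteMeasure μ] {N : Set X}
    (hN : ∀ x ∈ N, ∀ C > 0, ∃ r > 0, ENNReal.ofReal (C * r) < μ (closedBall x r)) :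
    μH[1] N = 0 := by
  choose u r hcount hr hcov hsum using fun m : ℕ =>
    exists_cover_of_large_density μ (N := N) (C := (m : ℝ) + 1) (by positivity)
      (fun x hx => hN x hx _ (by positivity))
  have hcs : ∀ m, Countable (u m) := fun m => (hcount m).to_subtype
  set M := (μ univ).toReal
  have hdiam : ∀ m (x : u m), ediam (closedBall (x : X) (5 * r m x)) ≤
      ENNReal.ofReal (10 * r m x) := by
    intro m x
    refine ediam_le_of_forall_dist_le fun y hy z hz => ?_
    refine (dist_triangle_right y z (x : X)).trans ?_
    rw [mem_closedBall] at hy hz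
    linarith
  have htend : Tendsto (fun m : ℕ => ENNReal.ofReal (10 * (M / ((m : ℝ) + 1)))) atTop (𝓝 0) := by
    rw [← ENNReal.ofReal_zero]
    refine ENNReal.tendsto_ofReal ?_
    have := (tendsto_one_div_add_atTop_nhds_zero_nat (𝕜 := ℝ)).const_mul (10 * M)
    rw [mul_zero] at this
    refine this.congr fun m => ?_
    ring
  have hmain := Measure.hausdorffMeasure_le_liminf_tsum 1 N _ htend
    (fun m (x : u m) => closedBall (x : X) (5 * r m x))
    (Eventually.of_forall fun m x => (hdiam m x).trans (ENNReal.ofReal_le_ofReal (by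
      have := (hr m x x.2).2; linarith)))
    (Eventually.of_forall fun m => by
      rw [iUnion_coe_set]; exact hcov m)
  refine le_antisymm (hmain.trans ?_) (zero_le)
  have hbound : ∀ m : ℕ, ∑' x : u m, ediam (closedBall (x : X) (5 * r m x)) ^ (1 : ℝ) ≤
      ENNReal.ofReal (10 * (M / ((m : ℝ) + 1))) := by
    intro m
    calc _ ≤ ∑' x : u m, ENNReal.ofReal 10 * ENNReal.ofReal (r m x) := by
          refine ENNReal.tsum_le_tsum fun x => ?_
          rw [ENNReal.rpow_one, ← ENNReal.ofReal_mul (by norm_num)]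
          exact hdiam m x
      _ = ENNReal.ofReal 10 * ∑' x : u m, ENNReal.ofReal (r m x) := ENNReal.tsum_mul_left
      _ ≤ ENNReal.ofReal 10 * (μ univ / ENNReal.ofReal ((m : ℝ) + 1)) := by gcongr; exact hsum m
      _ = _ := by
        rw [ENNReal.ofReal_mul (by norm_num), ENNReal.ofReal_div_of_pos (by positivity),
          ENNReal.ofReal_toReal (measure_ne_top _ _)]
  calc _ ≤ liminf (fun m : ℕ => ENNReal.ofReal (10 * (M / ((m : ℝ) + 1)))) atTop :=
        liminf_le_liminf (Eventually.of_forall hbound)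
    _ = 0 := htend.liminf_eq

lemma ae_exists_upper_bound {K : Set X} {μ : Measure X}
    (hμ : μ = μH[1].restrict K) [IsFiniteMeasure μ] :
    ∀ᵐ x ∂μ, ∃ C > 0, ∀ r > 0, μ (closedBall x r) ≤ ENNReal.ofReal (C * r) := by
  have key : μH[1] {x | ¬ ∃ C > 0, ∀ r > 0, μ (closedBall x r) ≤ ENNReal.ofReal (C * r)} = 0 := by
    refine hausdorffMeasure_eq_zero_of_large_density μ fun x hx C hC => ?_
    by_contra! h
    exact hx ⟨C, hC, h⟩
  have hle : μ ≤ μH[1] := hμ ▸ Measure.restrict_le_self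
  exact Measure.absolutelyContinuous_of_le hle key

end Hausdorff

section LowerDensity

variable {n : ℕ} {μ : Measure (EuclideanSpace ℝ (Fin n))} {x : EuclideanSpace ℝ (Fin n)}

lemma exists_lower_bound_of_lowerDensity1_pos (h : 0 < lowerDensity1 μ x) :
    ∃ c > 0, ∀ r, 0 < r → r ≤ 1 → ENNReal.ofReal (c * r) ≤ μ (closedBall x r) := by
  obtain ⟨a, ha0, ha⟩ := ENNReal.lt_iff_exists_nnreal_btwn.mp h
  have hev := eventually_lt_of_lt_liminf ha
  rw [eventually_nhdsWithin_iff, Metric.eventually_nhds_iff] at hev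
  obtain ⟨δ, hδ, hball⟩ := hev
  have ha' : (0 : ℝ) < a := by exact_mod_cast ha0
  have small : ∀ r, 0 < r → r < δ → ENNReal.ofReal (2 * a * r) ≤ μ (closedBall x r) := by
    intro r h0 h1
    have := hball (y := r) (by simpa [abs_of_pos h0] using h1) h0
    rw [ENNReal.lt_div_iff_mul_lt (Or.inl (by simpa using h0)) (Or.inl ENNReal.ofReal_ne_top)]
      at this
    refine le_trans (le_of_eq ?_) this.le
    rw [← ENNReal.ofReal_coe_nnreal, ← ENNReal.ofReal_mul ha'.le]
    congr 1; ring
  refine ⟨2 * a * min 1 (δ / 2), by positivity, fun r h0 h1 => ?_⟩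
  refine (ENNReal.ofReal_le_ofReal ?_).trans
    ((small (min 1 (δ / 2) * r) (by positivity) ?_).trans
      (measure_mono (closedBall_subset_closedBall ?_)))
  · rw [mul_assoc]
  · have : min 1 (δ / 2) ≤ δ / 2 := min_le_right _ _
    nlinarith
  · exact mul_le_of_le_one_left h0.le (min_le_left _ _)

lemma lowerDensity1_pos_of_lower_bound {c ρ : ℝ} (hc : 0 < c) (hρ : 0 < ρ)
    (h : ∀ r, 0 < r → r < ρ → ENNReal.ofReal (c * r) ≤ μ (closedBall x r)) :
    0 < lowerDensity1 μ x := by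
  refine lt_of_lt_of_le (b := ENNReal.ofReal (c / 2)) (ENNReal.ofReal_pos.mpr (by positivity)) ?_
  refine le_liminf_of_le (by isBoundedDefault) ?_
  filter_upwards [Ioo_mem_nhdsGT hρ] with r hr
  have hr0 : 0 < r := hr.1
  rw [ENNReal.le_div_iff_mul_le (Or.inl (by simpa using hr.1)) (Or.inl ENNReal.ofReal_ne_top),
    ← ENNReal.ofReal_mul (by positivity)]
  refine le_trans (ENNReal.ofReal_le_ofReal (le_of_eq ?_)) (h r hr.1 hr.2)
  ring

end LowerDensity

section Cubes

variable {n : ℕ} {μ : Measure (EuclideanSpace ℝ (Fin n))} {x : EuclideanSpace ℝ (Fin n)}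

lemma isLine_of_norm_eq_one (p : EuclideanSpace ℝ (Fin n)) {v : EuclideanSpace ℝ (Fin n)}
    (hv : ‖v‖ = 1) : IsLine {y | ∃ t : ℝ, y = p + t • v} :=
  ⟨p, v, by rintro rfl; simp at hv, rfl⟩

lemma infDist_line_le (p v y : EuclideanSpace ℝ (Fin n)) :
    infDist y {y | ∃ t : ℝ, y = p + t • v} ≤ ‖linePerp v (y - p)‖ := by
  refine (infDist_le_dist_of_mem (show p + inner ℝ (y - p) v • v ∈
    {y | ∃ t : ℝ, y = p + t • v} from ⟨_, rfl⟩)).trans (le_of_eq ?_)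
  rw [dist_eq_norm, linePerp]
  congr 1
  abel

lemma IsLine.exists_linePerp_le {L : Set (EuclideanSpace ℝ (Fin n))} (hL : IsLine L) :
    ∃ p v, ‖v‖ = 1 ∧ ∀ y, ‖linePerp v (y - p)‖ ≤ infDist y L := by
  obtain ⟨p, v, hv, rfl⟩ := hL
  have hv' : ‖v‖ ≠ 0 := norm_ne_zero_iff.mpr hv
  have hu : ‖(‖v‖⁻¹ • v)‖ = 1 := by
    rw [norm_smul, norm_inv, norm_norm, inv_mul_cancel₀ hv']
  refine ⟨p, ‖v‖⁻¹ • v, hu, fun y => ?_⟩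
  have hne : {x | ∃ t : ℝ, x = p + t • v}.Nonempty := ⟨p + (0 : ℝ) • v, 0, rfl⟩
  refine (le_infDist hne).mpr ?_
  rintro _ ⟨t, rfl⟩
  have h1 : y - p = (y - (p + t • v)) + (t * ‖v‖) • (‖v‖⁻¹ • v) := by
    rw [smul_smul, mul_assoc, mul_inv_cancel₀ hv', mul_one]; abel
  rw [h1, linePerp_add, linePerp_smul, linePerp_self hu, smul_zero, add_zero, dist_eq_norm]
  exact norm_linePerp_le hu _

lemma norm_le_of_forall_abs_le {w : EuclideanSpace ℝ (Fin n)} {s : ℝ} (hs : 0 ≤ s)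
    (h : ∀ i, |w i| ≤ s) : ‖w‖ ≤ n * s := by
  rw [EuclideanSpace.norm_eq, Real.sqrt_le_left (by positivity)]
  calc ∑ i, ‖w i‖ ^ 2 ≤ ∑ _i : Fin n, s ^ 2 := by
        refine Finset.sum_le_sum fun i _ => ?_
        exact pow_le_pow_left₀ (norm_nonneg _) (h i) 2
    _ = n * s ^ 2 := by simp
    _ ≤ (n * s) ^ 2 := by
      have : (n : ℝ) ≤ (n : ℝ) ^ 2 := by
        exact_mod_cast Nat.le_self_pow two_ne_zero n
      rw [mul_pow]
      gcongr

lemma closedBall_subset_dilatedCube {k : ℤ} {z : Fin n → ℤ} (hx : x ∈ dyadicCube n k z) :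
    closedBall x (2 ^ (-k)) ⊆ dilatedCube n 3 k z := by
  intro y hy i
  have h1 : |y i - x i| ≤ 2 ^ (-k) := by
    have := PiLp.norm_apply_le (y - x) i
    rw [mem_closedBall, dist_eq_norm] at hy
    exact this.trans hy
  have h2 := hx i
  rw [abs_le] at h1 ⊢
  constructor <;> linarith

lemma dilatedCube_subset_closedBall {k : ℤ} {z : Fin n → ℤ} (hx : x ∈ dyadicCube n k z) :
    dilatedCube n 3 k z ⊆ closedBall x (n * (2 * 2 ^ (-k))) := by
  intro y hy
  rw [mem_closedBall, dist_eq_norm]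
  refine norm_le_of_forall_abs_le (by positivity) fun i => ?_
  have h1 := abs_le.mp (hy i)
  have h2 := hx i
  rw [PiLp.sub_apply, abs_le]
  constructor <;> linarith

lemma diam_dilatedCube_le {k : ℤ} {z : Fin n → ℤ} (hx : x ∈ dyadicCube n k z) :
    diam (dilatedCube n 3 k z) ≤ 4 * n * 2 ^ (-k) := by
  refine (diam_mono (dilatedCube_subset_closedBall hx) isBounded_closedBall).trans ?_
  refine (diam_closedBall (by positivity)).trans (le_of_eq (by ring))

lemma le_diam_dilatedCube [Nontrivial (EuclideanSpace ℝ (Fin n))] {k : ℤ} {z : Fin n → ℤ}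
    (hx : x ∈ dyadicCube n k z) : (2 : ℝ) ^ (-k) ≤ diam (dilatedCube n 3 k z) := by
  obtain ⟨w, hw⟩ := exists_norm_eq (EuclideanSpace ℝ (Fin n)) (c := (2 : ℝ) ^ (-k)) (by positivity)
  have hb : Bornology.IsBounded (dilatedCube n 3 k z) :=
    isBounded_closedBall.subset (dilatedCube_subset_closedBall hx)
  have h := dist_le_diam_of_mem hb
    (closedBall_subset_dilatedCube hx (show x + w ∈ _ by simp [hw]))
    (closedBall_subset_dilatedCube hx (mem_closedBall_self (by positivity)))
  simpa [hw] using h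

lemma measurable_infDist_sq (L : Set (EuclideanSpace ℝ (Fin n))) :
    Measurable fun y => ENNReal.ofReal (infDist y L ^ 2) :=
  ENNReal.measurable_ofReal.comp ((continuous_infDist_pt L).measurable.pow_const 2)

lemma lintegral_infDist_div (L Q : Set (EuclideanSpace ℝ (Fin n))) :
    ∫⁻ y in Q, ENNReal.ofReal ((infDist y L / diam Q) ^ 2) ∂μ =
      (∫⁻ y in Q, ENNReal.ofReal (infDist y L ^ 2) ∂μ) * ENNReal.ofReal ((diam Q ^ 2)⁻¹) := by
  rw [← lintegral_mul_const _ (measurable_infDist_sq L)]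
  refine lintegral_congr fun y => ?_
  rw [← ENNReal.ofReal_mul (by positivity), div_pow, div_eq_mul_inv]

lemma ballErr_le_beta2Sq [Nontrivial (EuclideanSpace ℝ (Fin n))] {C : ℝ} (hC : 0 < C)
    (h : ∀ r > 0, μ (closedBall x r) ≤ ENNReal.ofReal (C * r))
    {k : ℤ} {z : Fin n → ℤ} (hx : x ∈ dyadicCube n k z) :
    ballErr μ x (2 ^ (-k)) ≤ ENNReal.ofReal (32 * n ^ 3 * C * (2 ^ (-k)) ^ 3) *
      beta2Sq μ (dilatedCube n 3 k z) := by
  set Q := dilatedCube n 3 k z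
  set s : ℝ := 2 ^ (-k) with hs
  have hs0 : 0 < s := by positivity
  have hn : 0 < (n : ℝ) := by
    rcases Nat.eq_zero_or_pos n with rfl | h0
    · exact absurd (inferInstance : Subsingleton (EuclideanSpace ℝ (Fin 0)))
        (not_subsingleton _)
    · exact_mod_cast h0
  have hμQ : μ Q ≤ ENNReal.ofReal (C * (n * (2 * s))) :=
    (measure_mono (dilatedCube_subset_closedBall hx)).trans (h _ (by positivity))
  have hd0 : 0 < diam Q := hs0.trans_le (le_diam_dilatedCube hx)
  have hd1 : diam Q ≤ 4 * n * s := diam_dilatedCube_le hx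
  have hpos : 0 < 32 * n ^ 3 * C * s ^ 3 := by positivity
  simp only [beta2Sq]
  rw [ENNReal.mul_iInf_of_ne (ENNReal.ofReal_pos.mpr hpos).ne' ENNReal.ofReal_ne_top]
  refine le_iInf fun L => ?_
  rw [ENNReal.mul_iInf_of_ne (ENNReal.ofReal_pos.mpr hpos).ne' ENNReal.ofReal_ne_top]
  refine le_iInf fun hL => ?_
  obtain ⟨p, v, hv, hpv⟩ := hL.exists_linePerp_le
  have h1 : ballErr μ x s ≤ ∫⁻ y in Q, ENNReal.ofReal (infDist y L ^ 2) ∂μ := by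
    refine (iInf_le_of_le p (iInf_le_of_le v (iInf_le _ hv))).trans ?_
    refine (lintegral_mono_set (closedBall_subset_dilatedCube hx)).trans ?_
    refine lintegral_mono fun y => ENNReal.ofReal_le_ofReal ?_
    exact pow_le_pow_left₀ (norm_nonneg _) (hpv y) 2
  rw [lintegral_infDist_div]
  set I := ∫⁻ y in Q, ENNReal.ofReal (infDist y L ^ 2) ∂μ with hI
  refine h1.trans ?_
  rcases eq_or_ne (μ Q) 0 with h0 | h0
  · have : I = 0 := by rw [hI, Measure.restrict_eq_zero.mpr h0, lintegral_zero_measure]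
    rw [this]; exact zero_le
  have htop : μ Q ≠ ⊤ := (hμQ.trans_lt ENNReal.ofReal_lt_top).ne
  calc I = ENNReal.ofReal (diam Q ^ 2) * μ Q *
        (I * ENNReal.ofReal ((diam Q ^ 2)⁻¹) / μ Q) := by
        rw [ENNReal.ofReal_inv_of_pos (by positivity), mul_assoc,
          ENNReal.mul_div_cancel h0 htop, mul_comm I, ← mul_assoc,
          ENNReal.mul_inv_cancel (ENNReal.ofReal_pos.mpr (by positivity)).ne'
            ENNReal.ofReal_ne_top, one_mul]
    _ ≤ _ := by
        gcongr
        calc ENNReal.ofReal (diam Q ^ 2) * μ Q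
            ≤ ENNReal.ofReal ((4 * n * s) ^ 2) * ENNReal.ofReal (C * (n * (2 * s))) := by gcongr
          _ = ENNReal.ofReal (32 * n ^ 3 * C * s ^ 3) := by
            rw [← ENNReal.ofReal_mul (by positivity)]; congr 1; ring

lemma beta2Sq_le_ballErr [Nontrivial (EuclideanSpace ℝ (Fin n))] {c : ℝ} (hc : 0 < c)
    {k : ℤ} {z : Fin n → ℤ} (hx : x ∈ dyadicCube n k z)
    (h : ENNReal.ofReal (c * 2 ^ (-k)) ≤ μ (closedBall x (2 ^ (-k)))) :
    beta2Sq μ (dilatedCube n 3 k z) ≤ ENNReal.ofReal ((c * (2 ^ (-k)) ^ 3)⁻¹) *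
      ballErr μ x (n * (2 * 2 ^ (-k))) := by
  set Q := dilatedCube n 3 k z
  set s : ℝ := 2 ^ (-k) with hs
  have hs0 : 0 < s := by positivity
  have hμQ : ENNReal.ofReal (c * s) ≤ μ Q :=
    h.trans (measure_mono (closedBall_subset_dilatedCube hx))
  have hd0 : s ≤ diam Q := le_diam_dilatedCube hx
  have hpos : 0 < (c * s ^ 3)⁻¹ := by positivity
  rw [ballErr, ENNReal.mul_iInf_of_ne (ENNReal.ofReal_pos.mpr hpos).ne' ENNReal.ofReal_ne_top]
  refine le_iInf fun p => ?_
  rw [ENNReal.mul_iInf_of_ne (ENNReal.ofReal_pos.mpr hpos).ne' ENNReal.ofReal_ne_top]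
  refine le_iInf fun v => ?_
  rw [ENNReal.mul_iInf_of_ne (ENNReal.ofReal_pos.mpr hpos).ne' ENNReal.ofReal_ne_top]
  refine le_iInf fun hv => ?_
  rw [beta2Sq]
  refine (iInf₂_le _ (isLine_of_norm_eq_one p hv)).trans ?_
  rw [lintegral_infDist_div, lineErr]
  have h1 : ∫⁻ y in Q, ENNReal.ofReal (infDist y {y | ∃ t : ℝ, y = p + t • v} ^ 2) ∂μ ≤
      ∫⁻ y in closedBall x (n * (2 * s)), ENNReal.ofReal (‖linePerp v (y - p)‖ ^ 2) ∂μ := by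
    refine (lintegral_mono_set (dilatedCube_subset_closedBall hx)).trans ?_
    refine lintegral_mono fun y => ENNReal.ofReal_le_ofReal ?_
    exact pow_le_pow_left₀ infDist_nonneg (infDist_line_le p v y) 2
  rw [div_eq_mul_inv, mul_assoc, mul_comm]
  refine mul_le_mul' ?_ h1
  have h2 : (μ Q)⁻¹ ≤ ENNReal.ofReal (c * s)⁻¹ := by
    rw [ENNReal.ofReal_inv_of_pos (by positivity)]
    exact ENNReal.inv_le_inv.mpr hμQ
  calc _ ≤ ENNReal.ofReal ((s ^ 2)⁻¹) * ENNReal.ofReal (c * s)⁻¹ := by gcongr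
    _ = _ := by
      rw [← ENNReal.ofReal_mul (by positivity)]; congr 1; field_simp

end Cubes

section JonesSum

variable {n : ℕ} {μ : Measure (EuclideanSpace ℝ (Fin n))} {x : EuclideanSpace ℝ (Fin n)}

lemma two_zpow_neg_natCast (k : ℕ) : (2 : ℝ) ^ (-(k : ℤ)) = (1 / 2) ^ k := by
  rw [zpow_neg, zpow_natCast, one_div, inv_pow]

lemma mem_dyadicCube_floor (x : EuclideanSpace ℝ (Fin n)) (k : ℤ) :
    x ∈ dyadicCube n k fun i => ⌊x i * 2 ^ k⌋ := by
  intro i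
  have h2 : (0 : ℝ) < 2 ^ k := by positivity
  rw [zpow_neg, ← div_eq_mul_inv, ← div_eq_mul_inv, div_le_iff₀ h2, le_div_iff₀ h2]
  exact ⟨Int.floor_le _, (Int.lt_floor_add_one _).le⟩

lemma eq_floor_of_mem_dyadicCube {k : ℤ} {z : Fin n → ℤ} (hx : x ∈ dyadicCube n k z) (i : Fin n) :
    z i = ⌊x i * 2 ^ k⌋ - 1 ∨ z i = ⌊x i * 2 ^ k⌋ := by
  have h2 : (0 : ℝ) < 2 ^ k := by positivity
  have h := hx i
  rw [zpow_neg, ← div_eq_mul_inv, ← div_eq_mul_inv, div_le_iff₀ h2, le_div_iff₀ h2] at h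
  have h3 : z i ≤ ⌊x i * 2 ^ k⌋ := Int.le_floor.mpr h.1
  have h4 : ⌊x i * 2 ^ k⌋ ≤ z i + 1 := by
    rw [← Int.floor_intCast (R := ℝ) (z i + 1)]
    exact Int.floor_mono (by push_cast; exact h.2)
  omega

lemma tsum_ballErr_le_jones2 [Nontrivial (EuclideanSpace ℝ (Fin n))] {C : ℝ} (hC : 0 < C)
    (h : ∀ r > 0, μ (closedBall x r) ≤ ENNReal.ofReal (C * r)) :
    ∑' k : ℕ, ENNReal.ofReal (8 ^ k) * ballErr μ x ((1 / 2) ^ k) ≤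
      ENNReal.ofReal (32 * n ^ 3 * C) * jones2 μ 1 x := by
  classical
  have h1 : ∑' k : ℕ, beta2Sq μ (dilatedCube n 3 k fun i => ⌊x i * 2 ^ (k : ℤ)⌋) ≤
      jones2 μ 1 x := by
    refine le_trans ?_ (ENNReal.tsum_comp_le_tsum_of_injective
      (f := fun k : ℕ => (k : ℤ)) Nat.cast_injective _)
    refine ENNReal.tsum_le_tsum fun k => ?_
    refine le_trans ?_ (ENNReal.le_tsum fun i => ⌊x i * 2 ^ (k : ℤ)⌋)
    rw [if_pos ⟨by
      rw [two_zpow_neg_natCast]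
      exact pow_le_one₀ (by norm_num) (by norm_num), mem_dyadicCube_floor x k⟩]
  refine le_trans ?_ (mul_le_mul_right h1 _)
  rw [← ENNReal.tsum_mul_left]
  refine ENNReal.tsum_le_tsum fun k => ?_
  have h2 := ballErr_le_beta2Sq hC h (mem_dyadicCube_floor x k)
  rw [two_zpow_neg_natCast] at h2
  refine (mul_le_mul_right h2 _).trans (le_of_eq ?_)
  rw [← mul_assoc, ← ENNReal.ofReal_mul (by positivity)]
  congr 2
  have : (8 : ℝ) ^ k * ((1 / 2) ^ k) ^ 3 = 1 := by
    rw [← pow_mul, mul_comm k 3, pow_mul, ← mul_pow]; norm_num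
  linear_combination (32 * n ^ 3 * C) * this

lemma jones2_le_tsum_ballErr [Nontrivial (EuclideanSpace ℝ (Fin n))] {c : ℝ} (hc : 0 < c)
    (h : ∀ r, 0 < r → r ≤ 1 → ENNReal.ofReal (c * r) ≤ μ (closedBall x r)) :
    jones2 μ 1 x ≤ 2 ^ n * (ENNReal.ofReal c⁻¹ *
      ∑' k : ℕ, ENNReal.ofReal (8 ^ k) * ballErr μ x (2 * n * (1 / 2) ^ k)) := by
  classical
  rw [← ENNReal.tsum_mul_left, ← ENNReal.tsum_mul_left, jones2]
  rw [← (Nat.cast_injective (R := ℤ)).tsum_eq]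
  · refine ENNReal.tsum_le_tsum fun k => ?_
    have hk : (2 : ℝ) ^ (-(k : ℤ)) ≤ 1 := by
      rw [two_zpow_neg_natCast]
      exact pow_le_one₀ (by norm_num) (by norm_num)
    let S : Finset (Fin n → ℤ) := Fintype.piFinset fun i =>
      {⌊x i * 2 ^ (k : ℤ)⌋ - 1, ⌊x i * 2 ^ (k : ℤ)⌋}
    rw [tsum_eq_sum (s := S)]
    · have hcard : S.card ≤ 2 ^ n := by
        rw [Fintype.card_piFinset]
        refine (Finset.prod_le_pow_card _ _ 2 fun i _ => Finset.card_le_two).trans (by simp)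
      refine (Finset.sum_le_card_nsmul S _ (ENNReal.ofReal c⁻¹ *
        (ENNReal.ofReal (8 ^ k) * ballErr μ x (2 * n * (1 / 2) ^ k))) fun z _ => ?_).trans ?_
      · split_ifs with hz
        · refine (beta2Sq_le_ballErr hc hz.2 (h _ (by positivity) hk)).trans (le_of_eq ?_)
          rw [two_zpow_neg_natCast, ← mul_assoc (ENNReal.ofReal c⁻¹),
            ← ENNReal.ofReal_mul (by positivity)]
          congr 2
          · rw [mul_inv, ← pow_mul, mul_comm k 3, pow_mul, ← inv_pow]; norm_num
          · ring
        · exact zero_le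
      · rw [nsmul_eq_mul]
        gcongr
        exact_mod_cast hcard
    · intro z hz
      rw [if_neg]
      rintro ⟨-, hx⟩
      refine hz (Fintype.mem_piFinset.mpr fun i => ?_)
      simpa using eq_floor_of_mem_dyadicCube hx i
  · intro k hk
    by_contra hneg
    refine hk ?_
    rw [ENNReal.tsum_eq_zero]
    intro z
    rw [if_neg]
    rintro ⟨h1, -⟩
    have : 0 ≤ k := by
      by_contra hlt
      have : (1 : ℝ) < 2 ^ (-k) := one_lt_zpow₀ (by norm_num) (by omega)
      linarith
    exact hneg ⟨k.toNat, by simp [this]⟩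

end JonesSum

lemma is1Rectifiable_of_ae {n : ℕ} (hn : 2 ≤ n) {K : Set (EuclideanSpace ℝ (Fin n))}
    {μ : Measure (EuclideanSpace ℝ (Fin n))} (hμ : μ = μH[1].restrict K) [IsFiniteMeasure μ]
    (h : ∀ᵐ x ∂μ, 0 < lowerDensity1 μ x ∧ jones2 μ 1 x < ⊤) : Is1Rectifiable μ := by
  have : Nontrivial (EuclideanSpace ℝ (Fin n)) := by
    have : Nonempty (Fin n) := ⟨⟨0, by omega⟩⟩
    infer_instance
  have hup := ae_exists_upper_bound hμ
  obtain ⟨R, C, g, hg, hA⟩ := exists_lipschitz_cover (μ := μ)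
    (A := {x | (0 < lowerDensity1 μ x ∧ jones2 μ 1 x < ⊤) ∧
      ∃ C > 0, ∀ r > 0, μ (closedBall x r) ≤ ENNReal.ofReal (C * r)})
    (fun x hx => exists_lower_bound_of_lowerDensity1_pos hx.1.1)
    (fun x ⟨_, C, _, hC⟩ => ⟨C, fun σ hσ _ => hC σ hσ⟩)
    (fun x ⟨hx, C, hC0, hC⟩ => ((tsum_ballErr_le_jones2 hC0 hC).trans_lt
      (ENNReal.mul_lt_top ENNReal.ofReal_lt_top hx.2)).ne)
  refine ⟨fun i => Icc (-(R i)) (R i), g, fun i => ⟨isBounded_Icc _ _, measurableSet_Icc,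
    C i, (hg i).lipschitzOnWith⟩, ?_⟩
  refine measure_mono_null ?_ (ae_iff.mp (h.and hup))
  intro x hx hx'
  exact hx.2 (hA hx')

section SecondDifference

variable {E : Type*} [NormedAddCommGroup E]

/-- The second difference of `g` at `t` with step `h`. -/
def secondDiff (g : ℝ → E) (h t : ℝ) : E := (g (t + 2 * h) - g (t + h)) - (g (t + h) - g t)

lemma Continuous.secondDiff {g : ℝ → E} (hg : Continuous g) (h : ℝ) :
    Continuous (secondDiff g h) := by
  unfold _root_.secondDiff; fun_prop

lemma lintegral_secondDiff_add [InnerProductSpace ℝ E] {g : ℝ → E} (hg : Continuous g) (h : ℝ) :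
    (∫⁻ t, ENNReal.ofReal (‖secondDiff g h t‖ ^ 2)) +
      ∫⁻ t, ENNReal.ofReal (‖g (t + 2 * h) - g t‖ ^ 2) =
      4 * ∫⁻ t, ENNReal.ofReal (‖g (t + h) - g t‖ ^ 2) := by
  have hm : ∀ {φ : ℝ → E}, Continuous φ → Measurable fun t => ENNReal.ofReal (‖φ t‖ ^ 2) :=
    fun hφ => (ENNReal.continuous_ofReal.comp (hφ.norm.pow 2)).measurable
  have hshift : ∫⁻ t, ENNReal.ofReal (‖g (t + 2 * h) - g (t + h)‖ ^ 2) =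
      ∫⁻ t, ENNReal.ofReal (‖g (t + h) - g t‖ ^ 2) := by
    rw [← lintegral_add_right_eq_self (μ := volume)
      (fun t => ENNReal.ofReal (‖g (t + h) - g t‖ ^ 2)) h]
    refine lintegral_congr fun t => ?_
    rw [show t + 2 * h = t + h + h by ring]
  have h4 : (4 : ℝ≥0∞) * ∫⁻ t, ENNReal.ofReal (‖g (t + h) - g t‖ ^ 2) =
      2 * ((∫⁻ t, ENNReal.ofReal (‖g (t + 2 * h) - g (t + h)‖ ^ 2)) +
        ∫⁻ t, ENNReal.ofReal (‖g (t + h) - g t‖ ^ 2)) := by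
    rw [hshift, ← two_mul, ← mul_assoc]; norm_num
  rw [h4, ← lintegral_add_left (hm (hg.secondDiff h)), ← lintegral_add_left (hm (by fun_prop)),
    ← lintegral_const_mul' _ _ (by norm_num)]
  refine lintegral_congr fun t => ?_
  rw [← ENNReal.ofReal_add (by positivity) (by positivity),
    ← ENNReal.ofReal_add (by positivity) (by positivity),
    show (2 : ℝ≥0∞) = ENNReal.ofReal 2 by simp, ← ENNReal.ofReal_mul (by norm_num)]
  congr 1
  have := parallelogram_law_with_norm ℝ (g (t + 2 * h) - g (t + h)) (g (t + h) - g t)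
  rw [sub_add_sub_cancel] at this
  rw [secondDiff]
  linarith

lemma lintegral_diff_sq_le {g : ℝ → E} {L : ℝ≥0} {R : ℝ} (hg : LipschitzWith L g)
    (hR : ∀ t, g t = g (max (-R) (min R t))) {h : ℝ} (hh : 0 ≤ h) :
    ∫⁻ t, ENNReal.ofReal (‖g (t + h) - g t‖ ^ 2) ≤
      ENNReal.ofReal ((L * h) ^ 2) * ENNReal.ofReal (2 * |R| + h) := by
  have hsupp : ∀ t, t ∉ Icc (-|R| - h) |R| → g (t + h) = g t := by
    intro t ht
    rw [hR (t + h), hR t]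
    congr 1
    rw [mem_Icc, not_and_or, not_le, not_le] at ht
    have h1 := le_abs_self R
    have h2 := neg_abs_le R
    rcases ht with ht | ht
    · rw [min_eq_right (by linarith), min_eq_right (by linarith)]
      rcases le_total 0 R with h0 | h0
      · rw [abs_of_nonneg h0] at ht
        rw [max_eq_left (by linarith), max_eq_left (by linarith)]
      · rw [max_eq_left (by linarith), max_eq_left (by linarith)]
    · rw [min_eq_left (by linarith), min_eq_left (by linarith)]
  calc ∫⁻ t, ENNReal.ofReal (‖g (t + h) - g t‖ ^ 2)
      ≤ ∫⁻ t, (Icc (-|R| - h) |R|).indicator (fun _ => ENNReal.ofReal ((L * h) ^ 2)) t := by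
        refine lintegral_mono fun t => ?_
        by_cases ht : t ∈ Icc (-|R| - h) |R|
        · rw [indicator_of_mem ht]
          refine ENNReal.ofReal_le_ofReal (pow_le_pow_left₀ (norm_nonneg _) ?_ 2)
          rw [← dist_eq_norm]
          refine (hg.dist_le_mul _ _).trans (le_of_eq ?_)
          rw [Real.dist_eq, add_sub_cancel_left, abs_of_nonneg hh]
        · simp [hsupp t ht]
    _ = _ := by
      rw [lintegral_indicator measurableSet_Icc, setLIntegral_const, Real.volume_Icc]
      congr 2; ring

lemma tsum_lintegral_secondDiff_lt_top [InnerProductSpace ℝ E] {g : ℝ → E} {L : ℝ≥0} {R : ℝ}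
    (hg : LipschitzWith L g)
    (hR : ∀ t, g t = g (max (-R) (min R t))) {h₀ : ℝ} (hh : 0 ≤ h₀) :
    ∑' m : ℕ, ENNReal.ofReal (4 ^ m) *
      ∫⁻ t, ENNReal.ofReal (‖secondDiff g (h₀ * (1 / 2) ^ (m + 1)) t‖ ^ 2) < ⊤ := by
  set u : ℕ → ℝ≥0∞ := fun m => ENNReal.ofReal (4 ^ m) *
    ∫⁻ t, ENNReal.ofReal (‖g (t + h₀ * (1 / 2) ^ m) - g t‖ ^ 2) with hu
  set B : ℝ≥0∞ := ENNReal.ofReal ((L * h₀) ^ 2) * ENNReal.ofReal (2 * |R| + h₀) with hB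
  have huB : ∀ m, u m ≤ B := by
    intro m
    have hp : h₀ * (1 / 2) ^ m ≤ h₀ :=
      mul_le_of_le_one_right hh (pow_le_one₀ (by norm_num) (by norm_num))
    refine (mul_le_mul_right (lintegral_diff_sq_le hg hR (by positivity)) _).trans ?_
    rw [← mul_assoc, ← ENNReal.ofReal_mul (by positivity)]
    refine mul_le_mul' (le_of_eq ?_) (ENNReal.ofReal_le_ofReal (by linarith))
    congr 1
    have : (4 : ℝ) ^ m * ((1 / 2) ^ m) ^ 2 = 1 := by
      rw [← pow_mul, mul_comm m 2, pow_mul, ← mul_pow]; norm_num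
    linear_combination ((L : ℝ) * h₀) ^ 2 * this
  have hstep : ∀ m, ENNReal.ofReal (4 ^ m) *
      (∫⁻ t, ENNReal.ofReal (‖secondDiff g (h₀ * (1 / 2) ^ (m + 1)) t‖ ^ 2)) + u m = u (m + 1) := by
    intro m
    have := lintegral_secondDiff_add hg.continuous (h₀ * (1 / 2) ^ (m + 1))
    rw [show 2 * (h₀ * (1 / 2) ^ (m + 1)) = h₀ * (1 / 2) ^ m by ring] at this
    simp only [hu]
    rw [← mul_add, this, ← mul_assoc, pow_succ (4 : ℝ), ENNReal.ofReal_mul (by positivity)]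
    simp
  have hsum : ∀ M, ∑ m ∈ Finset.range M, ENNReal.ofReal (4 ^ m) *
      (∫⁻ t, ENNReal.ofReal (‖secondDiff g (h₀ * (1 / 2) ^ (m + 1)) t‖ ^ 2)) + u 0 = u M := by
    intro M
    induction M with
    | zero => simp
    | succ M ih => rw [Finset.sum_range_succ, add_right_comm, ih, add_comm, hstep]
  have hBtop : B < ⊤ := ENNReal.mul_lt_top ENNReal.ofReal_lt_top ENNReal.ofReal_lt_top
  refine lt_of_le_of_lt ?_ hBtop
  rw [ENNReal.tsum_eq_iSup_nat]
  exact iSup_le fun M => (le_self_add.trans (hsum M).le).trans (huB M)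

lemma norm_le_of_secondDiff_le [InnerProductSpace ℝ E] {φ : ℝ → E} (hφ : Continuous φ)
    (h0 : φ 0 = 0) (h1 : φ 1 = 0) {σ : ℝ} (hσ : 0 ≤ σ) (h : ∀ l i : ℕ, i < 2 ^ l →
      ‖secondDiff φ ((1 / 2) ^ (l + 1)) (i * (1 / 2) ^ l)‖ ≤ (3 / 4) ^ l * σ)
    {s : ℝ} (hs : s ∈ Icc (0 : ℝ) 1) : ‖φ s‖ ≤ 2 * σ := by
  have key : ∀ l i : ℕ, i ≤ 2 ^ l → ‖φ (i * (1 / 2) ^ l)‖ ≤ 2 * (1 - (3 / 4) ^ l) * σ := by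
    intro l
    induction l with
    | zero =>
      intro i hi
      have : i = 0 ∨ i = 1 := by simp at hi; omega
      rcases this with rfl | rfl <;> simp [h0, h1]
    | succ l ih =>
      intro i hi
      rcases Nat.even_or_odd' i with ⟨j, rfl | rfl⟩
      · have e : ((2 * j : ℕ) : ℝ) * (1 / 2) ^ (l + 1) = j * (1 / 2) ^ l := by
          push_cast; ring
        rw [e]
        refine (ih j (by rw [pow_succ] at hi; omega)).trans ?_
        have : (3 / 4 : ℝ) ^ (l + 1) ≤ (3 / 4) ^ l :=
          pow_le_pow_of_le_one (by norm_num) (by norm_num) (by omega)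
        gcongr
      · have hj : j < 2 ^ l := by rw [pow_succ] at hi; omega
        have a1 := ih j hj.le
        have a2 := ih (j + 1) hj
        have a3 := h l j hj
        have e1 : (j : ℝ) * (1 / 2) ^ l + (1 / 2) ^ (l + 1) =
          ((2 * j + 1 : ℕ) : ℝ) * (1 / 2) ^ (l + 1) := by push_cast; ring
        have e2 : (j : ℝ) * (1 / 2) ^ l + 2 * (1 / 2) ^ (l + 1) =
          ((j + 1 : ℕ) : ℝ) * (1 / 2) ^ l := by push_cast; ring
        rw [secondDiff, e1, e2] at a3
        set a := φ (j * (1 / 2) ^ l)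
        set b := φ (((j + 1 : ℕ) : ℝ) * (1 / 2) ^ l)
        set m := φ (((2 * j + 1 : ℕ) : ℝ) * (1 / 2) ^ (l + 1))
        have e3 : (2 : ℝ) • m = a + b - ((b - m) - (m - a)) := by rw [two_smul]; abel
        have e4 : 2 * ‖m‖ ≤ ‖a‖ + ‖b‖ + ‖(b - m) - (m - a)‖ := by
          have : ‖(2 : ℝ) • m‖ = 2 * ‖m‖ := by rw [norm_smul]; norm_num
          rw [← this, e3]
          exact (norm_sub_le _ _).trans (by gcongr; exact norm_add_le _ _)
        rw [pow_succ]
        nlinarith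
  have hlim : Tendsto (fun l : ℕ => ((⌊s * 2 ^ l⌋₊ : ℕ) : ℝ) * (1 / 2) ^ l) atTop (𝓝 s) := by
    have h2 : Tendsto (fun l : ℕ => (2 : ℝ) ^ l) atTop atTop :=
      tendsto_pow_atTop_atTop_of_one_lt (by norm_num)
    refine ((tendsto_nat_floor_mul_div_atTop hs.1).comp h2).congr fun l => ?_
    simp [div_eq_mul_inv]
  refine le_of_tendsto ((hφ.norm.tendsto s).comp hlim) (Eventually.of_forall fun l => ?_)
  refine (key l _ ?_).trans ?_
  · have : s * 2 ^ l ≤ ((2 ^ l : ℕ) : ℝ) := by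
      push_cast
      exact mul_le_of_le_one_left (by positivity) hs.2
    exact Nat.floor_le_of_le this
  · have : (0 : ℝ) ≤ (3 / 4) ^ l := by positivity
    nlinarith

end SecondDifference

section SecondDiffSum

variable {E : Type*} [NormedAddCommGroup E]

/-- A weighted sum of squared second differences of `g` over the dyadic subdivisions of the
interval `[t, t + h₀ 2^(-k)]`. -/
def secondDiffSum (g : ℝ → E) (h₀ : ℝ) (k : ℕ) (t : ℝ) : ℝ≥0∞ :=
  ∑' l : ℕ, ENNReal.ofReal ((16 / 9) ^ l) * ∑ i ∈ Finset.range (2 ^ l),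
    ENNReal.ofReal (‖secondDiff g (h₀ * (1 / 2) ^ (k + l + 1))
      (t + i * (h₀ * (1 / 2) ^ (k + l)))‖ ^ 2)

lemma measurable_norm_secondDiff_sq {g : ℝ → E} (hg : Continuous g) (h : ℝ) :
    Measurable fun t => ENNReal.ofReal (‖secondDiff g h t‖ ^ 2) :=
  (ENNReal.continuous_ofReal.comp ((hg.secondDiff h).norm.pow 2)).measurable

lemma measurable_secondDiffSum {g : ℝ → E} (hg : Continuous g) (h₀ : ℝ) (k : ℕ) :
    Measurable (secondDiffSum g h₀ k) := by
  unfold secondDiffSum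
  refine Measurable.tsum fun l => Measurable.const_mul (Finset.measurable_sum _ fun i _ => ?_) _
  exact (measurable_norm_secondDiff_sq hg _).comp (measurable_id.add_const _)

lemma exists_line_of_secondDiffSum [InnerProductSpace ℝ E] [Nontrivial E] {g : ℝ → E}
    (hg : Continuous g) {h₀ : ℝ} (hh : 0 < h₀) (k : ℕ) (t : ℝ) :
    ∃ v : E, ‖v‖ = 1 ∧ ∀ s ∈ Icc t (t + h₀ * (1 / 2) ^ k),
      ENNReal.ofReal (‖linePerp v (g s - g t)‖ ^ 2) ≤ 4 * secondDiffSum g h₀ k t := by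
  obtain ⟨v₀, hv₀⟩ := exists_norm_eq E (c := 1) zero_le_one
  rcases eq_or_ne (secondDiffSum g h₀ k t) ⊤ with htop | htop
  · exact ⟨v₀, hv₀, fun s _ => by rw [htop]; simp⟩
  set H : ℝ := h₀ * (1 / 2) ^ k with hH
  have hH0 : 0 < H := by positivity
  set b : E := g (t + H) - g t with hb
  obtain ⟨v, c, hv, hvb⟩ : ∃ (v : E) (c : ℝ), ‖v‖ = 1 ∧ b = c • v := by
    rcases eq_or_ne b 0 with h | h
    · exact ⟨v₀, 0, hv₀, by simp [h]⟩
    · have h' : ‖b‖ ≠ 0 := norm_ne_zero_iff.mpr h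
      exact ⟨‖b‖⁻¹ • b, ‖b‖, by rw [norm_smul, norm_inv, norm_norm, inv_mul_cancel₀ h'],
        by rw [smul_smul, mul_inv_cancel₀ h', one_smul]⟩
  refine ⟨v, hv, fun s hs => ?_⟩
  set S := (secondDiffSum g h₀ k t).toReal with hS
  have hS0 : 0 ≤ S := ENNReal.toReal_nonneg
  set φ : ℝ → E := fun u => g (t + u * H) - g t - u • b with hφ
  have hdiff : ∀ h' u, secondDiff φ h' u = secondDiff g (h' * H) (t + u * H) := by
    intro h' u
    simp only [secondDiff, hφ]
    rw [show t + (u + 2 * h') * H = t + u * H + 2 * (h' * H) by ring,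
      show t + (u + h') * H = t + u * H + h' * H by ring]
    module
  have hterm : ∀ l i : ℕ, i < 2 ^ l →
      ‖secondDiff φ ((1 / 2) ^ (l + 1)) (i * (1 / 2) ^ l)‖ ≤ (3 / 4) ^ l * √S := by
    intro l i hi
    rw [hdiff]
    set w := secondDiff g ((1 / 2) ^ (l + 1) * H) (t + i * (1 / 2) ^ l * H) with hw
    have h1 : ENNReal.ofReal ((16 / 9) ^ l) * ENNReal.ofReal (‖w‖ ^ 2) ≤
        secondDiffSum g h₀ k t := by
      refine le_trans ?_ (ENNReal.le_tsum l)
      refine mul_le_mul_right ?_ _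
      refine le_trans (le_of_eq ?_) (Finset.single_le_sum (fun _ _ => zero_le)
        (Finset.mem_range.mpr hi))
      rw [hw, show (1 / 2 : ℝ) ^ (l + 1) * H = h₀ * (1 / 2) ^ (k + l + 1) by rw [hH]; ring,
        show t + i * (1 / 2 : ℝ) ^ l * H = t + i * (h₀ * (1 / 2) ^ (k + l)) by rw [hH]; ring]
    rw [← ENNReal.ofReal_mul (by positivity), ENNReal.ofReal_le_iff_le_toReal htop, ← hS] at h1
    refine abs_le_of_sq_le_sq' ?_ (by positivity) |>.2
    rw [mul_pow, Real.sq_sqrt hS0]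
    have h2 : ((3 / 4 : ℝ) ^ l) ^ 2 * (16 / 9) ^ l = 1 := by
      rw [← pow_mul, mul_comm l 2, pow_mul, ← mul_pow]; norm_num
    calc ‖w‖ ^ 2 = ((3 / 4 : ℝ) ^ l) ^ 2 * ((16 / 9) ^ l * ‖w‖ ^ 2) := by
          rw [← mul_assoc, h2, one_mul]
      _ ≤ _ := by gcongr
  have hmain := norm_le_of_secondDiff_le (φ := φ) (by fun_prop) (by simp [hφ])
    (by simp [hφ, hb]) (Real.sqrt_nonneg S) hterm (s := (s - t) / H)
    ⟨div_nonneg (by linarith [hs.1]) hH0.le, (div_le_one hH0).mpr (by linarith [hs.2])⟩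
  have hlin : ‖linePerp v (g s - g t)‖ ≤ 2 * √S := by
    have e : g s - g t = φ ((s - t) / H) + ((s - t) / H * c) • v := by
      simp only [hφ]
      rw [div_mul_cancel₀ _ hH0.ne', add_sub_cancel, hvb, smul_smul]
      abel
    rw [e, linePerp_add, linePerp_smul, linePerp_self hv, smul_zero, add_zero]
    exact (norm_linePerp_le hv _).trans hmain
  calc ENNReal.ofReal (‖linePerp v (g s - g t)‖ ^ 2) ≤ ENNReal.ofReal ((2 * √S) ^ 2) :=
        ENNReal.ofReal_le_ofReal (pow_le_pow_left₀ (norm_nonneg _) hlin 2)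
    _ = 4 * secondDiffSum g h₀ k t := by
      rw [mul_pow, Real.sq_sqrt hS0, ENNReal.ofReal_mul (by norm_num), hS,
        ENNReal.ofReal_toReal htop]
      norm_num

lemma lintegral_secondDiffSum {g : ℝ → E} (hg : Continuous g) (h₀ : ℝ) (k : ℕ) (c : ℝ) :
    ∫⁻ t, secondDiffSum g h₀ k (t + c) = ∑' l : ℕ, ENNReal.ofReal ((32 / 9) ^ l) *
      ∫⁻ t, ENNReal.ofReal (‖secondDiff g (h₀ * (1 / 2) ^ (k + l + 1)) t‖ ^ 2) := by
  have hm : ∀ l i : ℕ, Measurable fun t => ENNReal.ofReal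
      (‖secondDiff g (h₀ * (1 / 2) ^ (k + l + 1)) (t + i * (h₀ * (1 / 2) ^ (k + l)))‖ ^ 2) :=
    fun l i => (measurable_norm_secondDiff_sq hg _).comp (measurable_id.add_const _)
  rw [lintegral_add_right_eq_self (μ := volume) (secondDiffSum g h₀ k) c]
  unfold secondDiffSum
  rw [lintegral_tsum fun l => ((Finset.measurable_sum _ fun i _ => hm l i).const_mul _).aemeasurable]
  refine tsum_congr fun l => ?_
  rw [lintegral_const_mul _ (Finset.measurable_sum _ fun i _ => hm l i),
    lintegral_finsetSum _ fun i _ => hm l i]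
  rw [Finset.sum_congr rfl fun i _ => lintegral_add_right_eq_self (μ := volume)
    (fun t => ENNReal.ofReal (‖secondDiff g (h₀ * (1 / 2) ^ (k + l + 1)) t‖ ^ 2)) _,
    Finset.sum_const, Finset.card_range, nsmul_eq_mul, ← mul_assoc]
  congr 1
  rw [show ((2 ^ l : ℕ) : ℝ≥0∞) = ENNReal.ofReal (2 ^ l) by
    rw [ENNReal.ofReal_pow (by norm_num)]; simp, ← ENNReal.ofReal_mul (by positivity), ← mul_pow]
  norm_num

lemma ae_tsum_secondDiffSum_lt_top [InnerProductSpace ℝ E] {g : ℝ → E} {L : ℝ≥0} {R : ℝ}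
    (hg : LipschitzWith L g) (hR : ∀ t, g t = g (max (-R) (min R t))) {h₀ : ℝ} (hh : 0 ≤ h₀)
    (c : ℕ → ℝ) :
    ∀ᵐ t, ∑' k : ℕ, ENNReal.ofReal (4 ^ k) * secondDiffSum g h₀ k (t + c k) < ⊤ := by
  have hm : ∀ k, Measurable fun t => secondDiffSum g h₀ k (t + c k) := fun k =>
    (measurable_secondDiffSum hg.continuous h₀ k).comp (measurable_id.add_const _)
  refine ae_lt_top (Measurable.tsum fun k => (hm k).const_mul _) (ne_of_lt ?_)
  rw [lintegral_tsum fun k => ((hm k).const_mul _).aemeasurable]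
  set T : ℕ → ℝ≥0∞ := fun m =>
    ∫⁻ t, ENNReal.ofReal (‖secondDiff g (h₀ * (1 / 2) ^ (m + 1)) t‖ ^ 2) with hT
  set S := ∑' m : ℕ, ENNReal.ofReal (4 ^ m) * T m with hS
  have hStop : S < ⊤ := tsum_lintegral_secondDiff_lt_top hg hR hh
  have h1 : ∀ k, ∫⁻ t, ENNReal.ofReal (4 ^ k) * secondDiffSum g h₀ k (t + c k) =
      ∑' l : ℕ, ENNReal.ofReal ((8 / 9) ^ l) * (ENNReal.ofReal (4 ^ (k + l)) * T (k + l)) := by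
    intro k
    rw [lintegral_const_mul _ (hm k), lintegral_secondDiffSum hg.continuous,
      ← ENNReal.tsum_mul_left]
    refine tsum_congr fun l => ?_
    rw [← mul_assoc, ← mul_assoc, ← ENNReal.ofReal_mul (by positivity),
      ← ENNReal.ofReal_mul (by positivity)]
    congr 2
    rw [pow_add, mul_left_comm, ← mul_pow]
    norm_num
  rw [tsum_congr h1, ENNReal.tsum_comm]
  calc _ ≤ ∑' l : ℕ, ENNReal.ofReal ((8 / 9) ^ l) * S := by
        refine ENNReal.tsum_le_tsum fun l => ?_
        rw [ENNReal.tsum_mul_left]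
        exact mul_le_mul_right (ENNReal.tsum_comp_le_tsum_of_injective
          (add_left_injective l) (fun m => ENNReal.ofReal (4 ^ m) * T m)) _
    _ < ⊤ := by
        rw [ENNReal.tsum_mul_right, ← ENNReal.ofReal_tsum_of_nonneg (fun l => by positivity)
          (summable_geometric_of_lt_one (by norm_num) (by norm_num))]
        exact ENNReal.mul_lt_top ENNReal.ofReal_lt_top hStop

end SecondDiffSum

section DistanceSum

variable {E : Type*} [NormedAddCommGroup E] [MeasurableSpace E] [BorelSpace E]
  [SecondCountableTopology E] {μ : Measure E}

lemma tsum_four_pow_mul_sq_le {d R : ℝ} :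
    ∑' k : ℕ, ENNReal.ofReal (if 2 ^ k * d ≤ R ∧ 0 ≤ d then 4 ^ k * d ^ 2 else 0) ≤
      ENNReal.ofReal (4 / 3 * R ^ 2) := by
  have key : ∀ M : ℕ, ∑ k ∈ Finset.range M,
      (if 2 ^ k * d ≤ R ∧ 0 ≤ d then 4 ^ k * d ^ 2 else 0) ≤ 4 / 3 * R ^ 2 ∧
      ∑ k ∈ Finset.range M,
      (if 2 ^ k * d ≤ R ∧ 0 ≤ d then 4 ^ k * d ^ 2 else 0) ≤ 1 / 3 * (4 ^ M * d ^ 2) := by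
    intro M
    induction M with
    | zero => simp; constructor <;> positivity
    | succ M ih =>
      rw [Finset.sum_range_succ]
      have h4 : (4 : ℝ) ^ (M + 1) * d ^ 2 = 4 * (4 ^ M * d ^ 2) := by ring
      have h0 : (0 : ℝ) ≤ 4 ^ M * d ^ 2 := by positivity
      split_ifs with h
      · have h5 : (4 : ℝ) ^ M * d ^ 2 = (2 ^ M * d) ^ 2 := by
          rw [mul_pow, ← pow_mul, mul_comm M 2, pow_mul]; norm_num
        have h6 : (4 : ℝ) ^ M * d ^ 2 ≤ R ^ 2 := by
          rw [h5]
          exact pow_le_pow_left₀ (mul_nonneg (by positivity) h.2) h.1 2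
        constructor <;> linarith
      · constructor <;> linarith
  rw [ENNReal.tsum_eq_iSup_nat]
  refine iSup_le fun M => ?_
  rw [← ENNReal.ofReal_sum_of_nonneg fun k _ => by split_ifs <;> positivity]
  exact ENNReal.ofReal_le_ofReal (key M).1

lemma ae_tsum_infDist_lt_top [IsFiniteMeasure μ] {Γ : Set E} {D : ℝ}
    (hD : ∀ y, ∀ r > 0, μ (Γ ∩ closedBall y r) ≤ ENNReal.ofReal (D * r)) (hD0 : 0 ≤ D) {R : ℝ}
    (hR : 0 < R) :
    ∀ᵐ x ∂μ.restrict Γ, ∑' k : ℕ, ENNReal.ofReal (8 ^ k) *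
      ∫⁻ y in closedBall x (R * (1 / 2) ^ k), ENNReal.ofReal (infDist y Γ ^ 2) ∂μ < ⊤ := by
  set φ : E → ℝ≥0∞ := fun y => ENNReal.ofReal (infDist y Γ ^ 2) with hφ
  have hφm : Measurable φ := ENNReal.measurable_ofReal.comp
    ((continuous_infDist_pt Γ).measurable.pow_const 2)
  let F : ℝ → E × E → ℝ≥0∞ := fun r =>
    indicator {p : E × E | dist p.2 p.1 ≤ r} fun p => φ p.2
  have hFm : ∀ r, Measurable (F r) := fun r =>
    (hφm.comp measurable_snd).indicator
      (isClosed_le (continuous_snd.dist continuous_fst) continuous_const).measurableSet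
  have hF : ∀ r x, ∫⁻ y in closedBall x r, φ y ∂μ = ∫⁻ y, F r (x, y) ∂μ := by
    intro r x
    rw [← lintegral_indicator measurableSet_closedBall]
    rfl
  have hswap : ∀ r, ∫⁻ x in Γ, ∫⁻ y, F r (x, y) ∂μ ∂μ =
      ∫⁻ y, φ y * μ (Γ ∩ closedBall y r) ∂μ := by
    intro r
    rw [lintegral_lintegral_swap (f := fun x y => F r (x, y)) (hFm r).aemeasurable]
    refine lintegral_congr fun y => ?_
    have : ∀ x, F r (x, y) = (closedBall y r).indicator (fun _ => φ y) x := by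
      intro x
      simp only [F, indicator, mem_ofPred_eq, mem_closedBall, dist_comm]
    rw [lintegral_congr this, lintegral_indicator measurableSet_closedBall, setLIntegral_const,
      Measure.restrict_apply measurableSet_closedBall, inter_comm]
  simp only [hF]
  have hm : ∀ k : ℕ, Measurable fun x => ENNReal.ofReal (8 ^ k) *
      ∫⁻ y, F (R * (1 / 2) ^ k) (x, y) ∂μ := fun k =>
    (hFm _).lintegral_prod_right'.const_mul _
  refine ae_lt_top (Measurable.tsum hm) (ne_of_lt ?_)
  rw [lintegral_tsum fun k => (hm k).aemeasurable]
  have hterm : ∀ k : ℕ, ∫⁻ x in Γ, ENNReal.ofReal (8 ^ k) *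
      ∫⁻ y, F (R * (1 / 2) ^ k) (x, y) ∂μ ∂μ ≤ ∫⁻ y, ENNReal.ofReal (D * R) * ENNReal.ofReal
        (if 2 ^ k * infDist y Γ ≤ R ∧ 0 ≤ infDist y Γ then 4 ^ k * infDist y Γ ^ 2 else 0) ∂μ := by
    intro k
    rw [lintegral_const_mul _ (hFm _).lintegral_prod_right', hswap,
      ← lintegral_const_mul' _ _ ENNReal.ofReal_ne_top]
    refine lintegral_mono fun y => ?_
    rcases (Γ ∩ closedBall y (R * (1 / 2) ^ k)).eq_empty_or_nonempty with he | ⟨x, hxΓ, hx⟩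
    · rw [he, measure_empty, mul_zero, mul_zero]; exact zero_le
    · have h1 : infDist y Γ ≤ R * (1 / 2) ^ k :=
        (infDist_le_dist_of_mem hxΓ).trans (by rw [dist_comm]; exact hx)
      have h2 : 2 ^ k * infDist y Γ ≤ R := by
        calc 2 ^ k * infDist y Γ ≤ 2 ^ k * (R * (1 / 2) ^ k) := by gcongr
          _ = R := by rw [mul_left_comm, ← mul_pow]; norm_num
      rw [if_pos ⟨h2, infDist_nonneg⟩]
      refine (mul_le_mul_right (mul_le_mul_right (hD y _ (by positivity)) _) _).trans ?_
      rw [hφ, ← ENNReal.ofReal_mul (by positivity), ← ENNReal.ofReal_mul (by positivity),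
        ← ENNReal.ofReal_mul (by positivity)]
      refine ENNReal.ofReal_le_ofReal (le_of_eq ?_)
      have : (8 : ℝ) ^ k * (1 / 2) ^ k = 4 ^ k := by rw [← mul_pow]; norm_num
      rw [← this]; ring
  refine (ENNReal.tsum_le_tsum hterm).trans_lt ?_
  rw [← lintegral_tsum fun k => ?_]
  · refine lt_of_le_of_lt (lintegral_mono (g := fun _ => ENNReal.ofReal (D * R) *
      ENNReal.ofReal (4 / 3 * R ^ 2)) fun y => ?_) ?_
    · rw [ENNReal.tsum_mul_left]
      exact mul_le_mul_right tsum_four_pow_mul_sq_le _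
    · rw [lintegral_const]
      exact ENNReal.mul_lt_top (ENNReal.mul_lt_top ENNReal.ofReal_lt_top ENNReal.ofReal_lt_top)
        (measure_lt_top _ _)
  · have hd : Measurable fun y => infDist y Γ := (continuous_infDist_pt Γ).measurable
    refine (Measurable.const_mul (ENNReal.measurable_ofReal.comp (Measurable.ite ?_
      ((hd.pow_const 2).const_mul _) measurable_const)) _).aemeasurable
    exact (measurableSet_le (hd.const_mul _) measurable_const).inter
      (measurableSet_le measurable_const hd)

end DistanceSum

section BiLipschitz

variable {E : Type*} [NormedAddCommGroup E] [MeasurableSpace E] [BorelSpace E]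
  {g : ℝ → E} {L : ℝ≥0}

lemma LipschitzWith.hausdorffMeasure_one_image_le (hg : LipschitzWith L g) (S : Set ℝ) :
    μH[1] (g '' S) ≤ L * volume S := by
  have := hg.hausdorffMeasure_image_le zero_le_one S
  rwa [ENNReal.rpow_one, hausdorffMeasure_real] at this

lemma ae_of_ae_volume {K : Set E} {μ : Measure E} (hμ : μ = μH[1].restrict K)
    (hg : LipschitzWith L g) {P : ℝ → Prop} (hP : ∀ᵐ t, P t) :
    ∀ᵐ x ∂μ, ∀ t, g t = x → P t := by
  have h := hg.hausdorffMeasure_one_image_le {t | ¬ P t}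
  rw [ae_iff.mp hP, mul_zero, nonpos_iff_eq_zero] at h
  rw [hμ]
  refine ae_restrict_of_ae (measure_mono_null ?_ h)
  intro x hx
  simp only [mem_compl_iff, mem_ofPred_eq, not_forall] at hx
  obtain ⟨t, rfl, ht⟩ := hx
  exact ⟨t, ht, rfl⟩

lemma hausdorffMeasure_image_inter_closedBall_le (hg : LipschitzWith L g) {A : Set ℝ} {C : ℝ}
    (hC : 0 ≤ C) (hA : ∀ s ∈ A, ∀ t ∈ A, |s - t| ≤ C * ‖g s - g t‖) (y : E) (r : ℝ) :
    μH[1] (g '' A ∩ closedBall y r) ≤ ENNReal.ofReal (4 * L * C * r) := by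
  rcases (g '' A ∩ closedBall y r).eq_empty_or_nonempty with he | ⟨_, ⟨t, ht, rfl⟩, hty⟩
  · simp [he]
  have hsub : g '' A ∩ closedBall y r ⊆ g '' closedBall t (C * (2 * r)) := by
    rintro _ ⟨⟨s, hs, rfl⟩, hsy⟩
    refine ⟨s, ?_, rfl⟩
    rw [mem_closedBall, Real.dist_eq]
    refine (hA s hs t ht).trans (mul_le_mul_of_nonneg_left ?_ hC)
    rw [← dist_eq_norm]
    rw [mem_closedBall] at hsy hty
    linarith [dist_triangle_right (g s) (g t) y]
  refine (measure_mono hsub).trans ((hg.hausdorffMeasure_one_image_le _).trans ?_)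
  rw [Real.volume_closedBall, ← ENNReal.ofReal_coe_nnreal, ← ENNReal.ofReal_mul L.coe_nonneg]
  exact ENNReal.ofReal_le_ofReal (le_of_eq (by ring))

lemma volume_le_hausdorffMeasure_image {A : Set ℝ} {C : ℝ≥0}
    (hA : ∀ s ∈ A, ∀ t ∈ A, |s - t| ≤ C * ‖g s - g t‖) :
    volume A ≤ C * μH[1] (g '' A) := by
  have hinj : InjOn g A := by
    intro s hs t ht hst
    have := hA s hs t ht
    rw [hst, sub_self, norm_zero, mul_zero] at this
    exact sub_eq_zero.mp (abs_nonpos_iff.mp this)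
  have hlip : LipschitzOnWith C (Function.invFunOn g A) (g '' A) := by
    refine LipschitzOnWith.of_dist_le_mul ?_
    rintro _ ⟨s, hs, rfl⟩ _ ⟨t, ht, rfl⟩
    rw [hinj.leftInvOn_invFunOn hs, hinj.leftInvOn_invFunOn ht, Real.dist_eq, dist_eq_norm]
    exact hA s hs t ht
  have h := hlip.hausdorffMeasure_image_le zero_le_one
  rwa [hinj.leftInvOn_invFunOn.image_image, ENNReal.rpow_one, hausdorffMeasure_real] at h

end BiLipschitz

section Pieces

lemma ballErr_le_infDist_add {E : Type*} [NormedAddCommGroup E] [InnerProductSpace ℝ E]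
    [Nontrivial E] [MeasurableSpace E] [BorelSpace E] {μ : Measure E}
    {g : ℝ → E} (hg : Continuous g) {A : Set ℝ} (hA : IsCompact A) {C : ℝ} (hC : 0 ≤ C)
    (hanti : ∀ s ∈ A, ∀ t ∈ A, |s - t| ≤ C * ‖g s - g t‖) {t : ℝ} (ht : t ∈ A) {r h₀ : ℝ} {k : ℕ}
    (hh : 0 < h₀) (hr : 2 * C * r ≤ h₀ * (1 / 2) ^ k / 2) :
    ballErr μ (g t) r ≤ 2 * ∫⁻ y in closedBall (g t) r, ENNReal.ofReal (infDist y (g '' A) ^ 2) ∂μ +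
      8 * secondDiffSum g h₀ k (t + -(h₀ * (1 / 2) ^ k / 2)) * μ (closedBall (g t) r) := by
  set τ := t + -(h₀ * (1 / 2) ^ k / 2) with hτ
  obtain ⟨v, hv, hline⟩ := exists_line_of_secondDiffSum hg hh k τ
  have hφm : Measurable fun y : E => ENNReal.ofReal (infDist y (g '' A) ^ 2) :=
    ENNReal.measurable_ofReal.comp ((continuous_infDist_pt _).measurable.pow_const 2)
  refine (iInf_le_of_le (g τ) (iInf_le_of_le v (iInf_le _ hv))).trans ?_
  rw [lineErr, ← lintegral_const_mul _ hφm, ← setLIntegral_const,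
    ← lintegral_add_left (hφm.const_mul _)]
  refine setLIntegral_mono' measurableSet_closedBall fun y hy => ?_
  obtain ⟨_, ⟨s, hs, rfl⟩, hsy⟩ := (hA.image hg).exists_infDist_eq_dist ⟨_, mem_image_of_mem g ht⟩ y
  have h1 : dist y (g s) ≤ r := by
    rw [← hsy]
    exact (infDist_le_dist_of_mem (mem_image_of_mem g ht)).trans hy
  have h2 : |s - t| ≤ h₀ * (1 / 2) ^ k / 2 := by
    refine (hanti s hs t ht).trans (le_trans ?_ hr)
    rw [← dist_eq_norm, mul_comm 2 C, mul_assoc]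
    refine mul_le_mul_of_nonneg_left ?_ hC
    rw [mem_closedBall] at hy
    linarith [dist_triangle_left (g s) (g t) y]
  have h3 : s ∈ Icc τ (τ + h₀ * (1 / 2) ^ k) := by
    rw [abs_le] at h2
    constructor <;> rw [hτ] <;> linarith
  have h4 := hline s h3
  have h5 : ‖linePerp v (y - g τ)‖ ≤ infDist y (g '' A) + ‖linePerp v (g s - g τ)‖ := by
    rw [hsy, dist_eq_norm, ← sub_add_sub_cancel y (g s) (g τ), linePerp_add]
    exact (norm_add_le _ _).trans (by gcongr; exact norm_linePerp_le hv _)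
  calc ENNReal.ofReal (‖linePerp v (y - g τ)‖ ^ 2)
      ≤ ENNReal.ofReal (2 * infDist y (g '' A) ^ 2 + 2 * ‖linePerp v (g s - g τ)‖ ^ 2) := by
        refine ENNReal.ofReal_le_ofReal ?_
        refine (pow_le_pow_left₀ (norm_nonneg _) h5 2).trans ?_
        nlinarith [sq_nonneg (infDist y (g '' A) - ‖linePerp v (g s - g τ)‖)]
    _ = 2 * ENNReal.ofReal (infDist y (g '' A) ^ 2) +
        2 * ENNReal.ofReal (‖linePerp v (g s - g τ)‖ ^ 2) := by
        rw [ENNReal.ofReal_add (by positivity) (by positivity), ENNReal.ofReal_mul (by norm_num),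
          ENNReal.ofReal_mul (by norm_num)]
        simp
    _ ≤ 2 * ENNReal.ofReal (infDist y (g '' A) ^ 2) + 2 * (4 * secondDiffSum g h₀ k τ) := by
        gcongr
    _ = _ := by rw [← mul_assoc]; norm_num

variable {n : ℕ} {K : Set (EuclideanSpace ℝ (Fin n))} {μ : Measure (EuclideanSpace ℝ (Fin n))}
  {g : ℝ → EuclideanSpace ℝ (Fin n)} {L C : ℝ≥0} {A : Set ℝ}

lemma ae_lowerDensity1_pos_of_mem_image (hK : IsCompact K) (hμ : μ = μH[1].restrict K)
    (hg : LipschitzWith L g) (hA : IsCompact A) (hC : 0 < C)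
    (hanti : ∀ s ∈ A, ∀ t ∈ A, |s - t| ≤ C * ‖g s - g t‖) :
    ∀ᵐ x ∂μ, x ∈ g '' A → 0 < lowerDensity1 μ x := by
  have hT : MeasurableSet (A ∩ g ⁻¹' K) :=
    hA.measurableSet.inter (hK.isClosed.preimage hg.continuous).measurableSet
  have hdens := Besicovitch.ae_tendsto_measure_inter_div_of_measurableSet volume hT
  have hxK : ∀ᵐ x ∂μ, x ∈ K := hμ ▸ ae_restrict_mem hK.measurableSet
  filter_upwards [hxK, ae_of_ae_volume hμ hg hdens] with x hx hd
  rintro ⟨t, ht, rfl⟩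
  have h1 := hd t rfl
  rw [indicator_of_mem (show t ∈ A ∩ g ⁻¹' K from ⟨ht, hx⟩)] at h1
  have h2 : ∀ᶠ r in 𝓝[>] (0 : ℝ), 1 / 2 < volume ((A ∩ g ⁻¹' K) ∩ closedBall t r) /
      volume (closedBall t r) :=
    h1.eventually (lt_mem_nhds (by simp))
  rw [eventually_nhdsWithin_iff, Metric.eventually_nhds_iff] at h2
  obtain ⟨δ, hδ, h2⟩ := h2
  set M : ℝ := L + 1 with hM
  have hM0 : 0 < M := by positivity
  have hC' : (0 : ℝ) < C := hC
  refine lowerDensity1_pos_of_lower_bound (c := (M * C)⁻¹) (ρ := M * δ) (by positivity)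
    (by positivity) fun r hr hrδ => ?_
  have hr' : 0 < r / M := by positivity
  have h3 : 1 / 2 < volume ((A ∩ g ⁻¹' K) ∩ closedBall t (r / M)) / volume (closedBall t (r / M)) :=
    h2 (by rw [Real.dist_eq, sub_zero, abs_of_pos hr']; rw [div_lt_iff₀ hM0]; linarith) hr'
  set S := (A ∩ g ⁻¹' K) ∩ closedBall t (r / M) with hS
  have h4 : ENNReal.ofReal (r / M) ≤ volume S := by
    rw [Real.volume_closedBall] at h3
    have h5 := ENNReal.mul_le_of_le_div h3.le
    refine le_trans (le_of_eq ?_) h5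
    rw [ENNReal.ofReal_mul (by norm_num), ← mul_assoc, ENNReal.ofReal_ofNat, one_div,
      ENNReal.inv_mul_cancel (by norm_num) (by norm_num), one_mul]
  have h6 := volume_le_hausdorffMeasure_image (A := S) fun s hs t ht =>
    hanti s hs.1.1 t ht.1.1
  have h7 : μH[1] (g '' S) ≤ μ (closedBall (g t) r) := by
    rw [hμ, Measure.restrict_apply measurableSet_closedBall]
    refine measure_mono ?_
    rintro _ ⟨s, hs, rfl⟩
    refine ⟨?_, hs.1.2⟩
    have h8 : dist s t ≤ r / M := hs.2
    rw [mem_closedBall]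
    calc dist (g s) (g t) ≤ L * dist s t := hg.dist_le_mul _ _
      _ ≤ M * (r / M) := by gcongr; rw [hM]; linarith
      _ = r := by field_simp
  calc ENNReal.ofReal ((M * C)⁻¹ * r) = (C : ℝ≥0∞)⁻¹ * ENNReal.ofReal (r / M) := by
        rw [← ENNReal.ofReal_coe_nnreal, ← ENNReal.ofReal_inv_of_pos hC',
          ← ENNReal.ofReal_mul (by positivity)]
        congr 1
        field_simp
    _ ≤ (C : ℝ≥0∞)⁻¹ * (C * μ (closedBall (g t) r)) := by
        gcongr
        exact h4.trans (h6.trans (by gcongr))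
    _ = μ (closedBall (g t) r) := by
        rw [← mul_assoc, ENNReal.inv_mul_cancel (by exact_mod_cast hC.ne') ENNReal.coe_ne_top,
          one_mul]

lemma ae_jones2_lt_top_of_mem_image (hn : 0 < n) (hK : IsCompact K) (hμ : μ = μH[1].restrict K)
    [IsFiniteMeasure μ] (hg : LipschitzWith L g) {R : ℝ}
    (hR : ∀ t, g t = g (max (-R) (min R t))) (hA : IsCompact A) (hC : 0 < C)
    (hanti : ∀ s ∈ A, ∀ t ∈ A, |s - t| ≤ C * ‖g s - g t‖) :
    ∀ᵐ x ∂μ, x ∈ g '' A → jones2 μ 1 x < ⊤ := by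
  have : Nontrivial (EuclideanSpace ℝ (Fin n)) := by
    have : Nonempty (Fin n) := ⟨⟨0, hn⟩⟩
    infer_instance
  have hn' : (0 : ℝ) < n := by exact_mod_cast hn
  have hC' : (0 : ℝ) < C := hC
  set h₀ : ℝ := 8 * n * C with hh₀
  have hh : 0 < h₀ := by positivity
  have hsd := ae_of_ae_volume hμ hg (ae_tsum_secondDiffSum_lt_top hg hR hh.le
    fun k => -(h₀ * (1 / 2) ^ k / 2))
  have hdist : ∀ᵐ x ∂μ.restrict (g '' A), ∑' k : ℕ, ENNReal.ofReal (8 ^ k) *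
      ∫⁻ y in closedBall x (2 * n * (1 / 2) ^ k),
        ENNReal.ofReal (infDist y (g '' A) ^ 2) ∂μ < ⊤ := by
    refine ae_tsum_infDist_lt_top (D := 4 * L * C) (fun y r _ => ?_) (by positivity)
      (by positivity)
    refine (Measure.le_iff'.mp (hμ ▸ Measure.restrict_le_self) _).trans ?_
    exact hausdorffMeasure_image_inter_closedBall_le hg C.coe_nonneg hanti y r
  rw [ae_restrict_iff' (hA.image hg.continuous).measurableSet] at hdist
  filter_upwards [hsd, hdist, ae_exists_upper_bound hμ,
    ae_lowerDensity1_pos_of_mem_image hK hμ hg hA hC hanti] with x hsd hdist hup hlow hx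
  obtain ⟨c, hc, hcx⟩ := exists_lower_bound_of_lowerDensity1_pos (hlow hx)
  obtain ⟨N, hN, hNx⟩ := hup
  refine (jones2_le_tsum_ballErr hc hcx).trans_lt ?_
  refine ENNReal.mul_lt_top (by finiteness) (ENNReal.mul_lt_top ENNReal.ofReal_lt_top ?_)
  have hdx := hdist hx
  obtain ⟨t, ht, rfl⟩ := hx
  have hterm : ∀ k : ℕ, ENNReal.ofReal (8 ^ k) * ballErr μ (g t) (2 * n * (1 / 2) ^ k) ≤
      2 * (ENNReal.ofReal (8 ^ k) * ∫⁻ y in closedBall (g t) (2 * n * (1 / 2) ^ k),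
        ENNReal.ofReal (infDist y (g '' A) ^ 2) ∂μ) + ENNReal.ofReal (16 * N * n) *
      (ENNReal.ofReal (4 ^ k) * secondDiffSum g h₀ k (t + -(h₀ * (1 / 2) ^ k / 2))) := by
    intro k
    refine (mul_le_mul_right (ballErr_le_infDist_add hg.continuous hA C.coe_nonneg hanti ht hh
      (k := k) (le_of_eq (by rw [hh₀]; ring))) _).trans ?_
    rw [mul_add, mul_left_comm]
    refine add_le_add_right ?_ _
    refine (mul_le_mul_right (mul_le_mul_right (hNx _ (by positivity)) _) _).trans (le_of_eq ?_)
    have e : ENNReal.ofReal (8 ^ k) * 8 * ENNReal.ofReal (N * (2 * n * (1 / 2) ^ k)) =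
        ENNReal.ofReal (16 * N * n) * ENNReal.ofReal (4 ^ k) := by
      rw [show (8 : ℝ≥0∞) = ENNReal.ofReal 8 by simp, ← ENNReal.ofReal_mul (by positivity),
        ← ENNReal.ofReal_mul (by positivity), ← ENNReal.ofReal_mul (by positivity)]
      congr 1
      have : (8 : ℝ) ^ k * (1 / 2) ^ k = 4 ^ k := by rw [← mul_pow]; norm_num
      rw [← this]; ring
    rw [← mul_assoc (ENNReal.ofReal (16 * N * n)), ← e]
    ring
  refine (ENNReal.tsum_le_tsum hterm).trans_lt ?_
  rw [ENNReal.tsum_add, ENNReal.tsum_mul_left, ENNReal.tsum_mul_left]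
  exact ENNReal.add_lt_top.mpr ⟨ENNReal.mul_lt_top (by simp) hdx,
    ENNReal.mul_lt_top ENNReal.ofReal_lt_top (hsd t rfl)⟩

end Pieces

section Decomposition

variable {E : Type*} [NormedAddCommGroup E] [NormedSpace ℝ E] {g : ℝ → E}

lemma hausdorffMeasure_image_eq_zero_of_fderiv_eq_zero [SecondCountableTopology E]
    [MeasurableSpace E] [BorelSpace E] {D : Set ℝ} (hD : volume D ≠ ⊤)
    (hdiff : ∀ t ∈ D, HasFDerivAt g (0 : ℝ →L[ℝ] E) t) : μH[1] (g '' D) = 0 := by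
  have hle : ∀ ε : ℝ≥0, 0 < ε → μH[1] (g '' D) ≤ ε * volume D := by
    intro ε hε
    rcases D.eq_empty_or_nonempty with rfl | hne
    · simp
    obtain ⟨T, A, hTd, hTm, hcov, happ, hA⟩ :=
      exists_partition_approximatesLinearOn_of_hasFDerivWithinAt g D (fun _ => 0) (fun t ht => (hdiff t ht).hasFDerivWithinAt) (fun _ => ε) fun _ => hε.ne'
    have hpiece : ∀ m, μH[1] (g '' (D ∩ T m)) ≤ ε * volume (D ∩ T m) := by
      intro m
      obtain ⟨y, -, hy⟩ := hA hne m
      have hlip : LipschitzOnWith ε g (D ∩ T m) := by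
        refine LipschitzOnWith.of_dist_le_mul fun s hs t ht => ?_
        have := happ m s hs t ht
        rw [hy] at this
        simpa [dist_eq_norm] using this
      have := hlip.hausdorffMeasure_image_le zero_le_one
      rwa [ENNReal.rpow_one, hausdorffMeasure_real] at this
    calc μH[1] (g '' D) ≤ μH[1] (⋃ m, g '' (D ∩ T m)) := by
          rw [← image_iUnion, ← inter_iUnion, inter_eq_left.mpr hcov]
      _ ≤ ∑' m, μH[1] (g '' (D ∩ T m)) := measure_iUnion_le _
      _ ≤ ∑' m, ε * volume (D ∩ T m) := ENNReal.tsum_le_tsum hpiece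
      _ = ε * volume D := by
          rw [ENNReal.tsum_mul_left]
          congr 1
          have := measure_iUnion₀ (μ := volume.restrict D) (hTd.mono fun _ _ h => h.aedisjoint)
            fun m => (hTm m).nullMeasurableSet
          rw [Measure.restrict_apply (MeasurableSet.iUnion hTm), inter_comm,
            inter_eq_left.mpr hcov] at this
          rw [this]
          exact tsum_congr fun m => by rw [Measure.restrict_apply (hTm m), inter_comm]
  have hlim : Tendsto (fun ε : ℝ≥0 => (ε : ℝ≥0∞) * volume D) (𝓝[>] 0) (𝓝 0) := by
    have : Tendsto (fun ε : ℝ≥0 => (ε : ℝ≥0∞) * volume D) (𝓝 0) (𝓝 ((0 : ℝ≥0) * volume D)) :=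
      ENNReal.Tendsto.mul_const (ENNReal.tendsto_coe.mpr tendsto_id) (Or.inr hD)
    rw [ENNReal.coe_zero, zero_mul] at this
    exact this.mono_left nhdsWithin_le_nhds
  refine le_antisymm (ge_of_tendsto hlim ?_) zero_le
  filter_upwards [self_mem_nhdsWithin] with ε hε using hle ε hε

lemma exists_compact_antilipschitz_cover [SecondCountableTopology E] (hg : Continuous g)
    {D : Set ℝ} (hD : Bornology.IsBounded D)
    (hdiff : ∀ t ∈ D, DifferentiableAt ℝ g t ∧ fderiv ℝ g t ≠ 0) :
    ∃ (T : ℕ → Set ℝ) (C : ℕ → ℝ≥0), D ⊆ ⋃ m, T m ∧ ∀ m, IsCompact (T m) ∧ 0 < C m ∧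
      ∀ s ∈ T m, ∀ t ∈ T m, |s - t| ≤ C m * ‖g s - g t‖ := by
  classical
  rcases D.eq_empty_or_nonempty with rfl | hne
  · exact ⟨fun _ => ∅, fun _ => 1, by simp, fun m => by simp⟩
  let r : (ℝ →L[ℝ] E) → ℝ≥0 := fun A => if A = 0 then 1 else ‖A 1‖₊ / 2
  have hone : ∀ A : ℝ →L[ℝ] E, A ≠ 0 → 0 < ‖A 1‖₊ := by
    intro A hA
    rw [pos_iff_ne_zero, nnnorm_ne_zero_iff]
    exact fun h => hA (ContinuousLinearMap.ext_ring (by simpa using h))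
  have hr : ∀ A, r A ≠ 0 := by
    intro A
    simp only [r]
    split_ifs with h
    · exact one_ne_zero
    · exact (half_pos (hone A h)).ne'
  obtain ⟨T, A, -, -, hcov, happ, hA⟩ :=
    exists_partition_approximatesLinearOn_of_hasFDerivWithinAt g D (fderiv ℝ g) (fun t ht => (hdiff t ht).1.hasFDerivAt.hasFDerivWithinAt) r hr
  have hA0 : ∀ m, A m ≠ 0 := by
    intro m
    obtain ⟨y, hyD, hy⟩ := hA hne m
    rw [hy]
    exact (hdiff y hyD).2
  refine ⟨fun m => closure (D ∩ T m), fun m => 2 / ‖A m 1‖₊, fun t ht => ?_, fun m => ⟨?_, ?_, ?_⟩⟩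
  · obtain ⟨m, hm⟩ := mem_iUnion.mp (hcov ht)
    exact mem_iUnion.mpr ⟨m, subset_closure ⟨ht, hm⟩⟩
  · exact (hD.subset inter_subset_left).isCompact_closure
  · exact div_pos two_pos (hone _ (hA0 m))
  · have ha : 0 < ‖A m 1‖ := hone _ (hA0 m)
    have hbase : (D ∩ T m) ×ˢ (D ∩ T m) ⊆
        {p : ℝ × ℝ | |p.1 - p.2| ≤ (2 / ‖A m 1‖₊ : ℝ≥0) * ‖g p.1 - g p.2‖} := by
      rintro ⟨s, t⟩ ⟨hs, ht⟩
      have h1 := happ m s hs t ht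
      simp only [r, if_neg (hA0 m)] at h1
      have h2 : A m (s - t) = (s - t) • A m 1 := by
        rw [← map_smul, smul_eq_mul, mul_one]
      have h3 : ‖A m (s - t)‖ = |s - t| * ‖A m 1‖ := by
        rw [h2, norm_smul, Real.norm_eq_abs]
      have h4 := norm_sub_norm_le (A m (s - t)) (g s - g t)
      rw [norm_sub_rev (A m (s - t))] at h4
      have h5 : |s - t| * ‖A m 1‖ - ‖g s - g t‖ ≤ ‖A m 1‖ / 2 * |s - t| := by
        rw [← h3]
        exact h4.trans h1
      show |s - t| ≤ ((2 / ‖A m 1‖₊ : ℝ≥0) : ℝ) * ‖g s - g t‖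
      rw [NNReal.coe_div, coe_nnnorm, NNReal.coe_ofNat, div_mul_eq_mul_div, le_div_iff₀ ha]
      linarith
    have hcl : IsClosed {p : ℝ × ℝ | |p.1 - p.2| ≤ (2 / ‖A m 1‖₊ : ℝ≥0) * ‖g p.1 - g p.2‖} :=
      isClosed_le (by fun_prop) (by fun_prop)
    intro s hs t ht
    have hst : (s, t) ∈ closure ((D ∩ T m) ×ˢ (D ∩ T m)) := by
      rw [closure_prod_eq]; exact ⟨hs, ht⟩
    exact closure_minimal hbase hcl hst

end Decomposition

section Rectifiable

variable {n : ℕ} {K : Set (EuclideanSpace ℝ (Fin n))} {μ : Measure (EuclideanSpace ℝ (Fin n))}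

lemma ae_of_mem_lipschitz_image (hn : 0 < n) (hK : IsCompact K) (hμ : μ = μH[1].restrict K)
    [IsFiniteMeasure μ] {f : ℝ → EuclideanSpace ℝ (Fin n)} {S : Set ℝ} {L : ℝ≥0}
    (hf : LipschitzOnWith L f S) (hS : Bornology.IsBounded S) :
    ∀ᵐ x ∂μ, x ∈ f '' S → 0 < lowerDensity1 μ x ∧ jones2 μ 1 x < ⊤ := by
  obtain ⟨g₀, hg₀, hfg⟩ := hf.extend_finite_dimension
  obtain ⟨R, hR0, hSR⟩ := hS.subset_closedBall_lt 0 0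
  rw [Real.closedBall_eq_Icc, zero_sub, zero_add] at hSR
  set clamp : ℝ → ℝ := fun t => max (-R) (min R t) with hclamp
  have hclampL : LipschitzWith 1 clamp := (LipschitzWith.id.const_min R).const_max (-R)
  have hclampI : ∀ t ∈ Icc (-R) R, clamp t = t := fun t ht => by
    simp only [hclamp]; rw [min_eq_right ht.2, max_eq_right ht.1]
  have hclampM : ∀ t, clamp t ∈ Icc (-R) R := fun t =>
    ⟨le_max_left _ _, max_le (by linarith) (min_le_left _ _)⟩
  set g : ℝ → EuclideanSpace ℝ (Fin n) := fun t => g₀ (clamp t) with hgdef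
  have hg := hg₀.comp hclampL
  change LipschitzWith _ g at hg
  have hgR : ∀ t, g t = g (max (-R) (min R t)) := fun t => by
    change g₀ (clamp t) = g₀ (clamp (clamp t))
    rw [hclampI _ (hclampM t)]
  have hgS : ∀ t ∈ S, f t = g t := fun t ht => by
    simp only [hgdef]; rw [hclampI t (hSR ht), hfg ht]
  have hdiff := ae_of_ae_volume hμ hg (hg.ae_differentiableAt (μ := volume))
  let Z : Set ℝ := {t | t ∈ Icc (-R) R ∧ HasFDerivAt g (0 : ℝ →L[ℝ] EuclideanSpace ℝ (Fin n)) t}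
  have hzero : ∀ᵐ x ∂μ, x ∉ g '' Z := by
    have h0 : μH[1] (g '' Z) = 0 :=
      hausdorffMeasure_image_eq_zero_of_fderiv_eq_zero
        ((measure_mono fun t ht => ht.1).trans_lt measure_Icc_lt_top).ne fun t ht => ht.2
    rw [hμ]
    exact ae_restrict_of_ae (measure_mono_null (fun x hx => not_not.mp hx) h0)
  obtain ⟨T, C, hcov, hT⟩ := exists_compact_antilipschitz_cover hg.continuous
    (D := {t | t ∈ Icc (-R) R ∧ DifferentiableAt ℝ g t ∧ fderiv ℝ g t ≠ 0})
    ((isBounded_Icc _ _).subset fun t ht => ht.1) fun t ht => ht.2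
  have hlow := ae_all_iff.mpr fun m => ae_lowerDensity1_pos_of_mem_image hK hμ hg (hT m).1
    (hT m).2.1 (hT m).2.2
  have hjon := ae_all_iff.mpr fun m => ae_jones2_lt_top_of_mem_image hn hK hμ hg hgR (hT m).1
    (hT m).2.1 (hT m).2.2
  filter_upwards [hdiff, hzero, hlow, hjon] with x hdiff hzero hlow hjon
  rintro ⟨t, ht, htx⟩
  rw [hgS t ht] at htx
  have hd := hdiff t htx
  have hne : fderiv ℝ g t ≠ 0 := fun h0 =>
    hzero ⟨t, ⟨hSR ht, h0 ▸ hd.hasFDerivAt⟩, htx⟩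
  obtain ⟨m, hm⟩ := mem_iUnion.mp (hcov ⟨hSR ht, hd, hne⟩)
  exact ⟨hlow m ⟨t, hm, htx⟩, hjon m ⟨t, hm, htx⟩⟩

lemma Is1Rectifiable.ae_lowerDensity1_pos_and_jones2_lt_top (hn : 0 < n) (hK : IsCompact K)
    (hμ : μ = μH[1].restrict K) [IsFiniteMeasure μ] (h : Is1Rectifiable μ) :
    ∀ᵐ x ∂μ, 0 < lowerDensity1 μ x ∧ jones2 μ 1 x < ⊤ := by
  obtain ⟨S, f, hSf, h0⟩ := h
  have hcov : ∀ᵐ x ∂μ, x ∈ ⋃ i, f i '' S i := by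
    rw [ae_iff]
    refine measure_mono_null (fun x hx => ?_) h0
    exact ⟨mem_univ x, hx⟩
  have hall := ae_all_iff.mpr fun i => ae_of_mem_lipschitz_image hn hK hμ
    (hSf i).2.2.choose_spec (hSf i).1
  filter_upwards [hcov, hall] with x hx hall
  obtain ⟨i, hi⟩ := mem_iUnion.mp hx
  exact hall i hi

end Rectifiable

/-- Let `n ≥ 2`, `K ⊆ ℝⁿ` compact and `μ = H¹⌞K` finite. Then `μ` is
`1`-rectifiable iff both `Θ¹_*(μ,x) > 0` and `J₂(μ,x) < ∞` at `μ`-a.e. `x ∈ ℝⁿ`. -/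
theorem is1Rectifiable_iff_lowerDensity_pos_and_jones2_lt_top (n : ℕ) (hn : 2 ≤ n)
    (K : Set (EuclideanSpace ℝ (Fin n))) (hK : IsCompact K)
    (μ : Measure (EuclideanSpace ℝ (Fin n))) (hμ : μ = μH[1].restrict K)
    (hfin : IsFiniteMeasure μ) :
    Is1Rectifiable μ ↔ ∀ᵐ x ∂μ, 0 < lowerDensity1 μ x ∧ jones2 μ 1 x < ⊤ :=
  ⟨fun h => h.ae_lowerDensity1_pos_and_jones2_lt_top (by omega) hK hμ,
    fun h => is1Rectifiable_of_ae hn hμ h⟩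

end
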